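/- arXiv:1705.10839 — 8 statements merged into one kernel-verified Lean document; each statement's English description precedes it below -/
import Mathlib

section
/- Let I ⊂ ℝ be a compact interval, φ : I → (0,∞) smooth, ρ̄ ∈ I, Γ(r) = ∫_{ρ̄}^r ds/φ(s), J = Γ(I), and ψ = φ ∘ Γ⁻¹ : J → (0,∞). If ρ : ℝ × [0,T) → I is smooth, 2π-periodic in its first variable, and solves the one-dimensional Guan–Li flow equation ∂ₜρ = ∂ₓ( ∂ₓρ / √(φ(ρ)² + (∂ₓρ)²) ) + (φ'(ρ)/φ(ρ)) · (∂ₓρ)² / √(φ(ρ)² + (∂ₓρ)²), then γ := Γ ∘ ρ is smooth, 2π-periodic in its first variable, and solves the transformed flow equation ∂ₜγ = (1/ψ(γ)) · ∂²ₓγ / (1 + (∂ₓγ)²)^{3/2} + (ψ'(γ)/ψ(γ)²) · (∂ₓγ)² / √(1 + (∂ₓγ)²). -/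
open Real Set Filter

/-- The distance on the circle `ℝ / 2πℤ`: `d(x,y) = min_{j ∈ ℤ} |x - y + 2πj|`. -/
noncomputable def circleDist (x y : ℝ) : ℝ := ⨅ j : ℤ, |x - y + 2 * π * j|

/-- The optimal modulus of continuity of a `2π`-periodic function `f : ℝ → ℝ`:
`ω_f(θ) = sup { |f y - f x| : d(x,y) = θ }`. -/
noncomputable def modCont (f : ℝ → ℝ) (θ : ℝ) : ℝ :=
  sSup {v : ℝ | ∃ x y : ℝ, circleDist x y = θ ∧ v = |f y - f x|}

/-- `ρ` solves the one-dimensional (`n = 1`) Guan–Li flow equation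
`∂ₜρ = ∂ₓ(∂ₓρ / √(φ(ρ)² + (∂ₓρ)²)) + (φ'(ρ)/φ(ρ)) (∂ₓρ)² / √(φ(ρ)² + (∂ₓρ)²)`
at the point `(x, t)`. -/
def SolvesGuanLi (φ : ℝ → ℝ) (ρ : ℝ → ℝ → ℝ) (x t : ℝ) : Prop :=
  deriv (fun s => ρ x s) t =
    deriv (fun y => deriv (fun z => ρ z t) y /
        Real.sqrt ((φ (ρ y t)) ^ 2 + (deriv (fun z => ρ z t) y) ^ 2)) x
    + (deriv φ (ρ x t) / φ (ρ x t)) * (deriv (fun z => ρ z t) x) ^ 2 /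
        Real.sqrt ((φ (ρ x t)) ^ 2 + (deriv (fun z => ρ z t) x) ^ 2)

/-- `γ` solves the transformed flow equation
`∂ₜγ = (1/ψ(γ)) ∂²_θγ / (1 + (∂_θγ)²)^{3/2} + (ψ'(γ)/ψ(γ)²) (∂_θγ)² / √(1 + (∂_θγ)²)`
at the point `(θ, t)`. -/
def SolvesTrans (ψ : ℝ → ℝ) (γ : ℝ → ℝ → ℝ) (θ t : ℝ) : Prop :=
  deriv (fun s => γ θ s) t =
    (1 / ψ (γ θ t)) *
        (deriv (deriv (fun z => γ z t)) θ / (1 + (deriv (fun z => γ z t) θ) ^ 2) ^ ((3:ℝ)/2))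
    + (deriv ψ (γ θ t) / (ψ (γ θ t)) ^ 2) *
        ((deriv (fun z => γ z t) θ) ^ 2 / Real.sqrt (1 + (deriv (fun z => γ z t) θ) ^ 2))

/-- `ζ` is a (pointwise) subsolution of the transformed flow equation at `(θ, t)`. -/
def SubSolTrans (ψ : ℝ → ℝ) (ζ : ℝ → ℝ → ℝ) (θ t : ℝ) : Prop :=
  deriv (fun s => ζ θ s) t ≤
    (1 / ψ (ζ θ t)) *
        (deriv (deriv (fun z => ζ z t)) θ / (1 + (deriv (fun z => ζ z t) θ) ^ 2) ^ ((3:ℝ)/2))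
    + (deriv ψ (ζ θ t) / (ψ (ζ θ t)) ^ 2) *
        ((deriv (fun z => ζ z t) θ) ^ 2 / Real.sqrt (1 + (deriv (fun z => ζ z t) θ) ^ 2))

/-- The fundamental theorem of calculus for a continuous function on `[a, b]`, endpoints
included. -/
theorem hasDerivWithinAt_integral_Icc {f : ℝ → ℝ} {a b c r : ℝ} (hf : ContinuousOn f (Icc a b))
    (hc : c ∈ Icc a b) (hr : r ∈ Icc a b) :
    HasDerivWithinAt (fun u => ∫ s in c..u, f s) (f r) (Icc a b) r := by
  have : Fact (r ∈ Icc a b) := ⟨hr⟩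
  exact intervalIntegral.integral_hasDerivWithinAt_right
    (hf.mono (uIcc_subset_Icc hc hr)).intervalIntegrable
    (hf.stronglyMeasurableAtFilter_nhdsWithin measurableSet_Icc r) (hf r hr)

/-- A primitive of a smooth function on `[a, b]` is smooth on `[a, b]`. -/
theorem contDiffOn_integral_Icc {f : ℝ → ℝ} {a b c : ℝ}
    (hf : ContDiffOn ℝ (⊤ : ℕ∞) f (Icc a b)) (hc : c ∈ Icc a b) :
    ContDiffOn ℝ (⊤ : ℕ∞) (fun u => ∫ s in c..u, f s) (Icc a b) := by
  rcases (hc.1.trans hc.2).eq_or_lt with rfl | hab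
  · rw [Icc_self]
    exact (contDiffOn_const (c := ∫ s in c..a, f s)).congr
      fun x hx => by rw [mem_singleton_iff.mp hx]
  · have hd := fun r (hr : r ∈ Icc a b) => hasDerivWithinAt_integral_Icc hf.continuousOn hc hr
    exact (contDiffOn_infty_iff_derivWithin (uniqueDiffOn_Icc hab)).2
      ⟨fun r hr => (hd r hr).differentiableWithinAt,
        hf.congr fun r hr => (hd r hr).derivWithin (uniqueDiffOn_Icc hab r hr)⟩

/-- A primitive of a positive continuous function on `[a, b]` is strictly increasing there. -/
theorem strictMonoOn_integral_Icc {f : ℝ → ℝ} {a b c : ℝ} (hf : ContinuousOn f (Icc a b))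
    (hpos : ∀ s ∈ Icc a b, 0 < f s) (hc : c ∈ Icc a b) :
    StrictMonoOn (fun u => ∫ s in c..u, f s) (Icc a b) := by
  have hd := fun r (hr : r ∈ Icc a b) => hasDerivWithinAt_integral_Icc hf hc hr
  refine strictMonoOn_of_deriv_pos (convex_Icc a b) (fun r hr => (hd r hr).continuousWithinAt)
    fun r hr => ?_
  rw [((hd r (interior_subset hr)).hasDerivAt (mem_interior_iff_mem_nhds.1 hr)).deriv]
  exact hpos r (interior_subset hr)

/-- The chain rule for `φ ∘ Γ⁻¹` at an interior point `Γ r`, where `Γ' = 1 / φ`. -/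
theorem deriv_comp_invFunOn {φ Γ : ℝ → ℝ} {I : Set ℝ} {r : ℝ} (hI : I ∈ nhds r)
    (hφ : DifferentiableAt ℝ φ r) (hφr : φ r ≠ 0) (hinj : InjOn Γ I)
    (hΓ : HasStrictDerivAt Γ (1 / φ r) r) :
    deriv (φ ∘ Function.invFunOn Γ I) (Γ r) = deriv φ r * φ r := by
  have hleft := hinj.leftInvOn_invFunOn
  have hinv := (hΓ.to_local_left_inverse (one_div_ne_zero hφr)
    (Filter.eventually_of_mem hI hleft)).hasDerivAt
  simpa using (hφ.hasDerivAt.comp_of_eq _ hinv (hleft (mem_of_mem_nhds hI)).symm).deriv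

/-- A differentiable function with values in `[a, b]` has zero derivative wherever it takes a
boundary value. -/
theorem deriv_eq_zero_of_notMem_Ioo {u : ℝ → ℝ} {a b x : ℝ} (hu : ∀ y, u y ∈ Icc a b)
    (hx : u x ∉ Ioo a b) : deriv u x = 0 := by
  rcases (hu x).1.eq_or_lt with h | h
  · exact IsLocalMin.deriv_eq_zero (Filter.Eventually.of_forall fun y => h ▸ (hu y).1)
  · have hb : b = u x := le_antisymm (not_lt.1 fun hlt => hx ⟨h, hlt⟩) (hu x).2
    exact IsLocalMax.deriv_eq_zero (Filter.Eventually.of_forall fun y => hb ▸ (hu y).2)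

/-- With `q = p / f`, one has `(p / √(f² + p²))' = q' / (1 + q²)^{3/2}`. -/
theorem deriv_div_sqrt_sq_add_sq {p f : ℝ → ℝ} {x : ℝ} (hp : DifferentiableAt ℝ p x)
    (hf : DifferentiableAt ℝ f x) (hpos : 0 < f x) :
    deriv (fun y => p y / √(f y ^ 2 + p y ^ 2)) x =
      deriv (fun y => p y / f y) x / (1 + (p x / f x) ^ 2) ^ ((3 : ℝ) / 2) := by
  have hQ : DifferentiableAt ℝ (fun y => p y / f y) x := hp.div hf hpos.ne'
  have hev : (fun y => p y / √(f y ^ 2 + p y ^ 2)) =ᶠ[nhds x]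
      fun y => (p y / f y) / √(1 + (p y / f y) ^ 2) := by
    filter_upwards [hf.continuousAt.eventually (lt_mem_nhds hpos)] with y hy
    have h : f y ^ 2 + p y ^ 2 = f y ^ 2 * (1 + (p y / f y) ^ 2) := by field_simp
    rw [h, Real.sqrt_mul (sq_nonneg _), Real.sqrt_sq hy.le, div_div]
  have hD : ∀ q : ℝ → ℝ, ∀ q' : ℝ, HasDerivAt q q' x →
      deriv (fun y => q y / √(1 + q y ^ 2)) x = q' / (1 + q x ^ 2) ^ ((3 : ℝ) / 2) := by
    intro q q' hq
    have hpos' : 0 < 1 + q x ^ 2 := by positivity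
    have hs := Real.sqrt_pos.2 hpos'
    have hsq := Real.sq_sqrt hpos'.le
    have hpow : (1 + q x ^ 2) ^ ((3 : ℝ) / 2) = √(1 + q x ^ 2) ^ 3 := by
      rw [Real.sqrt_eq_rpow, ← Real.rpow_mul_natCast hpos'.le]
      norm_num
    have h := (hq.div (((hq.pow 2).const_add 1).sqrt hpos'.ne') hs.ne').deriv
    refine h.trans ?_
    simp only [Pi.pow_apply]
    rw [hpow]
    field_simp
    rw [hsq]
    ring
  rw [hev.deriv_eq, hD _ _ hQ.hasDerivAt]

/-- **The change of unknown (Th1Eq2)–(Th1Eq3), case `n = 1`.**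
If `ρ` solves the one-dimensional Guan–Li flow with values in `I`, then
`γ = Γ ∘ ρ`, where `Γ(r) = ∫_{ρ̄}^r ds/φ(s)` and `ψ = φ ∘ Γ⁻¹`, is smooth, `2π`-periodic
in its first variable, and solves the transformed flow equation. -/
theorem change_of_unknown_transforms_flow
    (a b : ℝ) (hab : a ≤ b) (I : Set ℝ) (hI : I = Icc a b)
    (φ : ℝ → ℝ) (hφ : ContDiffOn ℝ (⊤ : ℕ∞) φ I) (hφpos : ∀ s ∈ I, 0 < φ s)
    (rb : ℝ) (hrb : rb ∈ I)
    (Γ : ℝ → ℝ) (hΓ : ∀ r, Γ r = ∫ s in rb..r, 1 / φ s)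
    (J : Set ℝ) (hJ : J = Γ '' I)
    (ψ : ℝ → ℝ) (hψ : ψ = φ ∘ Function.invFunOn Γ I)
    (T : ℝ) (hT : 0 < T)
    (ρ : ℝ → ℝ → ℝ)
    (hρsmooth : ContDiffOn ℝ (⊤ : ℕ∞) (Function.uncurry ρ) (univ ×ˢ Ico 0 T))
    (hρper : ∀ x t, ρ (x + 2 * π) t = ρ x t)
    (hρrange : ∀ x t, t ∈ Ico 0 T → ρ x t ∈ I)
    (hρeq : ∀ x t, t ∈ Ioo 0 T → SolvesGuanLi φ ρ x t) :
    ContDiffOn ℝ (⊤ : ℕ∞) (Function.uncurry (fun x t => Γ (ρ x t))) (univ ×ˢ Ico 0 T) ∧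
    (∀ x t, Γ (ρ (x + 2 * π) t) = Γ (ρ x t)) ∧
    (∀ x t, t ∈ Ioo 0 T → SolvesTrans ψ (fun x t => Γ (ρ x t)) x t) := by
  subst hI hψ
  obtain rfl : Γ = fun r => ∫ s in rb..r, 1 / φ s := funext hΓ
  have hg : ContDiffOn ℝ (⊤ : ℕ∞) (fun s => 1 / φ s) (Icc a b) :=
    contDiffOn_const.div hφ fun s hs => (hφpos s hs).ne'
  have hgd := fun r (hr : r ∈ Icc a b) => hasDerivWithinAt_integral_Icc hg.continuousOn hrb hr
  have hinj := (strictMonoOn_integral_Icc hg.continuousOn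
    (fun s hs => one_div_pos.2 (hφpos s hs)) hrb).injOn
  have hleft := hinj.leftInvOn_invFunOn
  have hsmooth := contDiffOn_integral_Icc hg hrb
  refine ⟨hsmooth.comp hρsmooth fun p hp => hρrange p.1 p.2 hp.2,
    fun x t => by rw [hρper], fun x t ht => ?_⟩
  have htIco : t ∈ Ico 0 T := Ioo_subset_Ico_self ht
  have hu : ContDiff ℝ (⊤ : ℕ∞) (fun z => ρ z t) :=
    contDiffOn_univ.1 <| hρsmooth.comp (contDiff_prodMk_left t).contDiffOn
      fun z _ => ⟨mem_univ z, htIco⟩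
  have hur : ∀ z, ρ z t ∈ Icc a b := fun z => hρrange z t htIco
  have hf : ContDiff ℝ (⊤ : ℕ∞) (fun z => φ (ρ z t)) :=
    contDiffOn_univ.1 <| hφ.comp hu.contDiffOn fun z _ => hur z
  have hρt : DifferentiableAt ℝ (fun s => ρ x s) t :=
    ((hρsmooth.comp (contDiff_prodMk_right x).contDiffOn
      fun s hs => ⟨mem_univ x, hs⟩).contDiffAt (Ico_mem_nhds ht.1 ht.2)).differentiableAt (by simp)
  have hp : Differentiable ℝ (deriv fun z => ρ z t) :=
    (contDiff_infty_iff_deriv.1 hu).2.differentiable (by simp)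
  have hfx : 0 < φ (ρ x t) := hφpos _ (hur x)
  have hγt := ((hgd _ (hur x)).comp_hasDerivAt t hρt.hasDerivAt
    (Filter.eventually_of_mem (Ioo_mem_nhds ht.1 ht.2)
      fun s hs => hρrange x s (Ioo_subset_Ico_self hs))).deriv
  have hγx : (deriv fun z => ∫ s in rb..ρ z t, 1 / φ s) =
      fun y => deriv (fun z => ρ z t) y / φ (ρ y t) := by
    funext y
    refine ((hgd _ (hur y)).comp_hasDerivAt y (hu.differentiable (by simp) y).hasDerivAt
      (Filter.Eventually.of_forall hur)).deriv.trans (one_div_mul_eq_div _ _)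
  have hkey := deriv_div_sqrt_sq_add_sq (hp x) (hf.differentiable (by simp) x) hfx
  have hsqrt : √(φ (ρ x t) ^ 2 + deriv (fun z => ρ z t) x ^ 2) =
      φ (ρ x t) * √(1 + (deriv (fun z => ρ z t) x / φ (ρ x t)) ^ 2) := by
    have h : φ (ρ x t) ^ 2 + deriv (fun z => ρ z t) x ^ 2 =
        φ (ρ x t) ^ 2 * (1 + (deriv (fun z => ρ z t) x / φ (ρ x t)) ^ 2) := by field_simp
    rw [h, Real.sqrt_mul (sq_nonneg _), Real.sqrt_sq hfx.le]
  have hψx : (φ ∘ Function.invFunOn (fun r => ∫ s in rb..r, 1 / φ s) (Icc a b))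
      (∫ s in rb..ρ x t, 1 / φ s) = φ (ρ x t) := congrArg φ (hleft (hur x))
  have heq := hρeq x t ht
  unfold SolvesGuanLi at heq
  unfold SolvesTrans
  refine hγt.trans ?_
  simp only [hγx]
  rw [heq, hkey, hsqrt, hψx]
  by_cases hx : ρ x t ∈ Ioo a b
  · have hI : Icc a b ∈ nhds (ρ x t) := Icc_mem_nhds hx.1 hx.2
    have hstrict : HasStrictDerivAt (fun r => ∫ s in rb..r, 1 / φ s) (1 / φ (ρ x t)) (ρ x t) :=
      (hsmooth.contDiffAt hI).hasStrictDerivAt' ((hgd _ (hur x)).hasDerivAt hI) (by simp)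
    rw [deriv_comp_invFunOn hI ((hφ.contDiffAt hI).differentiableAt (by simp)) hfx.ne' hinj
      hstrict]
    have hs : 0 < √(1 + (deriv (fun z => ρ z t) x / φ (ρ x t)) ^ 2) := by positivity
    generalize √(1 + (deriv (fun z => ρ z t) x / φ (ρ x t)) ^ 2) = S at hs ⊢
    rw [mul_add]
    congr 1
    field_simp
  · rw [deriv_eq_zero_of_notMem_Ioo hur hx]
    simp
end

section
/- Let f : ℝ → ℝ be a differentiable 2π-periodic function and let κ : [0,π] → ℝ be differentiable with κ'(π) > 0 (one-sided derivative at π). Define Z(x,y) := f(y) − f(x) − κ(d(x,y)) for x, y ∈ ℝ, where d(x,y) = min_{j∈ℤ} |x − y + 2πj| is the circle distance. Then Z does not attain its supremum over ℝ × ℝ at any pair (x,y) with d(x,y) = π; that is, at every maximum point of Z one has d(x,y) < π. -/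
open Real Set

/-- A representative `t ∈ [-π, π]` of `x - y` modulo `2π` computes the circle distance. -/
theorem circleDist_eq_abs {x y t : ℝ} (k : ℤ) (ht : |t| ≤ π) (h : x - y = t + 2 * π * k) :
    circleDist x y = |t| := by
  have hbdd : BddBelow (range fun j : ℤ => |x - y + 2 * π * j|) :=
    ⟨0, by rintro _ ⟨j, rfl⟩; exact abs_nonneg _⟩
  apply le_antisymm
  · refine (ciInf_le hbdd (-k)).trans (le_of_eq ?_)
    rw [h]
    push_cast
    congr 1
    ring
  · refine le_ciInf fun j => ?_
    have hj : x - y + 2 * π * j = t + 2 * π * ((k + j : ℤ) : ℝ) := by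
      rw [h]
      push_cast
      ring
    rw [hj]
    rcases eq_or_ne (k + j) 0 with h0 | h0
    · simp [h0]
    · have h1 : (1 : ℝ) ≤ |((k + j : ℤ) : ℝ)| := by
        exact_mod_cast Int.one_le_abs h0
      have h2 : |2 * π * ((k + j : ℤ) : ℝ)| = 2 * π * |((k + j : ℤ) : ℝ)| := by
        rw [abs_mul, abs_of_pos two_pi_pos]
      have h3 := abs_sub_abs_le_abs_sub (2 * π * ((k + j : ℤ) : ℝ)) (-t)
      rw [abs_neg, sub_neg_eq_add, add_comm _ t, h2] at h3
      nlinarith [pi_pos]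

/-- Every real number has a representative in `[-π, π]` modulo `2π`. -/
theorem exists_abs_le_pi_add_two_pi_mul (u : ℝ) :
    ∃ (t : ℝ) (k : ℤ), |t| ≤ π ∧ u = t + 2 * π * k := by
  refine ⟨u - 2 * π * round (u / (2 * π)), round (u / (2 * π)), ?_, by ring⟩
  have h := abs_sub_round (u / (2 * π))
  have hu : u - 2 * π * round (u / (2 * π)) = 2 * π * (u / (2 * π) - round (u / (2 * π))) := by
    have := pi_ne_zero
    field_simp
  rw [hu, abs_mul, abs_of_pos two_pi_pos]
  nlinarith [pi_pos]

/-- A one-sided derivative at a left endpoint maximum is nonpositive. -/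
theorem HasDerivWithinAt.nonpos_of_forall_le_left {g : ℝ → ℝ} {g' a b : ℝ} (hab : a < b)
    (hg : HasDerivWithinAt g g' (Icc a b) a) (hmax : ∀ s ∈ Icc a b, g s ≤ g a) : g' ≤ 0 := by
  have hg' : HasDerivWithinAt g g' (Ioo a b) a := hg.mono Ioo_subset_Icc_self
  rw [hasDerivWithinAt_iff_tendsto_slope' (by simp)] at hg'
  have : (nhdsWithin a (Ioo a b)).NeBot := by
    rw [nhdsWithin_Ioo_eq_nhdsGT hab]
    infer_instance
  refine le_of_tendsto hg' (eventually_nhdsWithin_of_forall fun s hs => ?_)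
  rw [slope_def_field]
  exact div_nonpos_of_nonpos_of_nonneg (sub_nonpos.2 (hmax s (Ioo_subset_Icc_self hs)))
    (sub_nonneg.2 hs.1.le)

/-- **Step 2 in the proof of Theorem 1** (one-dimensional case).
If `f` is differentiable and `2π`-periodic, `κ` is differentiable on `[0,π]` with one-sided
derivative `κ'(π) > 0`, and `Z(x,y) = f(y) - f(x) - κ(d(x,y))`, then no maximum point of `Z`
has `d(x,y) = π`; that is, at a maximum point `d(x,y) < π`. -/
theorem max_of_doubled_function_not_antipodal
    (f : ℝ → ℝ) (hf : Differentiable ℝ f) (hper : ∀ x, f (x + 2 * π) = f x)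
    (κ : ℝ → ℝ) (hκ : DifferentiableOn ℝ κ (Icc 0 π))
    (hκ' : 0 < derivWithin κ (Icc 0 π) π)
    (x y : ℝ)
    (hmax : ∀ x' y' : ℝ,
      f y' - f x' - κ (circleDist x' y') ≤ f y - f x - κ (circleDist x y)) :
    circleDist x y < π := by
  obtain ⟨t, k, ht, hxy⟩ := exists_abs_le_pi_add_two_pi_mul (x - y)
  have hd := circleDist_eq_abs k ht hxy
  rw [hd] at hmax ⊢
  refine lt_of_le_of_ne ht fun htπ => ?_
  rw [htπ] at hmax
  obtain ⟨m, hm⟩ : ∃ m : ℤ, x - y = π + 2 * π * m := by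
    rcases eq_or_eq_neg_of_abs_eq htπ with h | h
    · exact ⟨k, by rw [hxy, h]⟩
    · refine ⟨k - 1, ?_⟩
      rw [hxy, h]
      push_cast
      ring
  have hκπ : HasDerivWithinAt κ (derivWithin κ (Icc 0 π) π) (Icc 0 π) (π - 0) := by
    rw [sub_zero]
    exact (hκ π (right_mem_Icc.2 pi_pos.le)).hasDerivWithinAt
  have hκ₀ := hκπ.comp (0 : ℝ) (((hasDerivAt_id (0 : ℝ)).const_sub π).hasDerivWithinAt)
    (s := Icc 0 π) fun s hs => ⟨sub_nonneg.2 hs.2, sub_le_self _ hs.1⟩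
  have hadd : HasDerivAt (fun s => f (y + s)) (deriv f y) 0 := by
    apply HasDerivAt.comp_const_add
    rw [add_zero]
    exact (hf y).hasDerivAt
  have hsub : HasDerivAt (fun s => f (y - s)) (-deriv f y) 0 := by
    apply HasDerivAt.comp_const_sub
    rw [sub_zero]
    exact (hf y).hasDerivAt
  have hg := ((hadd.add hsub).hasDerivWithinAt (s := Icc 0 π)).sub (hκ₀.const_mul 2)
  have hle := hg.nonpos_of_forall_le_left pi_pos fun s hs => by
    have habs : |π - s| = π - s := abs_of_nonneg (sub_nonneg.2 hs.2)
    have hπs : |π - s| ≤ π := habs.trans_le (sub_le_self _ hs.1)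
    have h1 := hmax x (y + s)
    have h2 := hmax x (y - s)
    rw [circleDist_eq_abs (t := π - s) m hπs (by linarith), habs] at h1
    rw [circleDist_eq_abs (t := -(π - s)) (m + 1) (by rwa [abs_neg])
      (by push_cast; linarith), abs_neg, habs] at h2
    simp only [Pi.sub_apply, Pi.add_apply, Function.comp_apply, add_zero, sub_zero]
    linarith
  linarith
end

section
/- Let a, b ∈ ℝ and θ ∈ (0,π), and define φ(s) := (a·sin(θ − s) + b·sin(s)) / sin(θ) for s ∈ [0,θ]. Then ∫₀^θ ( φ'(s)² − φ(s)² ) ds = (cos θ / sin θ)·(a − b)² − 2ab·tan(θ/2). Moreover, if a > 0 and b > 0, then ∫₀^θ ( φ'(s)² − φ(s)² ) ds ≤ (a − b)²/θ. -/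
open Real Set

/-- On `(0, π)` the cotangent is bounded by the reciprocal. -/
theorem cos_div_sin_le_inv {θ : ℝ} (hθ : θ ∈ Ioo 0 π) :
    Real.cos θ / Real.sin θ ≤ 1 / θ := by
  obtain ⟨h0, hπ⟩ := hθ
  have hs : 0 < Real.sin θ := Real.sin_pos_of_pos_of_lt_pi h0 hπ
  rw [div_le_div_iff₀ hs h0, one_mul]
  rcases le_or_gt (Real.cos θ) 0 with hc | hc
  · exact (mul_nonpos_of_nonpos_of_nonneg hc h0.le).trans hs.le
  · have hlt : θ < π / 2 := by
      by_contra! h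
      exact hc.not_ge (Real.cos_nonpos_of_pi_div_two_le_of_le h (by linarith))
    have ht := Real.lt_tan h0 hlt
    rw [Real.tan_eq_sin_div_cos, lt_div_iff₀ hc] at ht
    linarith

/-- The half-angle formula for the tangent, away from the zeros of the sine. -/
theorem tan_half_eq_one_sub_cos_div_sin {θ : ℝ} (hs : Real.sin θ ≠ 0) :
    Real.tan (θ / 2) = (1 - Real.cos θ) / Real.sin θ := by
  have hsin : Real.sin θ = 2 * Real.sin (θ / 2) * Real.cos (θ / 2) := by
    rw [← Real.sin_two_mul, mul_div_cancel₀ θ two_ne_zero]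
  have hcos : Real.cos θ = 1 - 2 * Real.sin (θ / 2) ^ 2 := by
    have h := Real.cos_two_mul (θ / 2)
    rw [mul_div_cancel₀ θ two_ne_zero, Real.cos_sq'] at h
    linarith
  have hc : Real.cos (θ / 2) ≠ 0 := fun h => hs (by rw [hsin, h, mul_zero])
  rw [Real.tan_eq_sin_div_cos, div_eq_div_iff hc hs, hsin, hcos]
  ring

/-- **The integration-by-parts computation (Th1St3Eq16)** in Step 3 of the proof of
Theorem 1: for `φ(s) = (a sin(θ-s) + b sin s)/sin θ` on `[0,θ]` with `θ ∈ (0,π)`,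
`∫₀^θ (φ'² - φ²) = (cos θ / sin θ)(a-b)² - 2ab tan(θ/2)`, and this is at most
`(a-b)²/θ` when `a, b > 0`. -/
theorem sine_barrier_energy_identity
    (a b θ : ℝ) (hθ : θ ∈ Ioo 0 π)
    (φ : ℝ → ℝ) (hφ : ∀ s, φ s = (a * Real.sin (θ - s) + b * Real.sin s) / Real.sin θ) :
    (∫ s in (0:ℝ)..θ, ((deriv φ s) ^ 2 - (φ s) ^ 2)) =
        (Real.cos θ / Real.sin θ) * (a - b) ^ 2 - 2 * a * b * Real.tan (θ / 2) ∧
    (0 < a → 0 < b →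
      (∫ s in (0:ℝ)..θ, ((deriv φ s) ^ 2 - (φ s) ^ 2)) ≤ (a - b) ^ 2 / θ) := by
  have hs : 0 < Real.sin θ := Real.sin_pos_of_pos_of_lt_pi hθ.1 hθ.2
  set ψ : ℝ → ℝ := fun s => (b * Real.cos s - a * Real.cos (θ - s)) / Real.sin θ with hψ
  have hsub (s : ℝ) : HasDerivAt (fun s => θ - s) (-1) s := (hasDerivAt_id s).const_sub θ
  have hφ_deriv (s : ℝ) : HasDerivAt φ (ψ s) s := by
    rw [funext hφ]
    refine ((((hsub s).sin.const_mul a).add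
      ((Real.hasDerivAt_sin s).const_mul b)).div_const (Real.sin θ)).congr_deriv ?_
    simp only [hψ]
    ring
  have hψ_deriv (s : ℝ) : HasDerivAt ψ (-φ s) s := by
    refine ((((Real.hasDerivAt_cos s).const_mul b).sub
      ((hsub s).cos.const_mul a)).div_const (Real.sin θ)).congr_deriv ?_
    rw [hφ]
    ring
  have hφ_cont : Continuous φ :=
    continuous_iff_continuousAt.2 fun s => (hφ_deriv s).continuousAt
  have hψ_cont : Continuous ψ :=
    continuous_iff_continuousAt.2 fun s => (hψ_deriv s).continuousAt
  have hint : (∫ s in (0:ℝ)..θ, ((deriv φ s) ^ 2 - (φ s) ^ 2)) = φ θ * ψ θ - φ 0 * ψ 0 := by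
    simp only [fun s => (hφ_deriv s).deriv]
    refine intervalIntegral.integral_eq_sub_of_hasDerivAt (f := fun s => φ s * ψ s)
      (fun s _ => ((hφ_deriv s).mul (hψ_deriv s)).congr_deriv (by ring)) ?_
    exact ((hψ_cont.pow 2).sub (hφ_cont.pow 2)).intervalIntegrable _ _
  have hvalue : (∫ s in (0:ℝ)..θ, ((deriv φ s) ^ 2 - (φ s) ^ 2)) =
      (Real.cos θ / Real.sin θ) * (a - b) ^ 2 - 2 * a * b * Real.tan (θ / 2) := by
    rw [hint, tan_half_eq_one_sub_cos_div_sin hs.ne', hφ, hφ]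
    simp only [hψ, sub_self, sub_zero, Real.sin_zero, Real.cos_zero]
    field_simp
    ring
  refine ⟨hvalue, fun ha hb => ?_⟩
  have htan : 0 ≤ Real.tan (θ / 2) :=
    Real.tan_nonneg_of_nonneg_of_le_pi_div_two (by linarith [hθ.1]) (by linarith [hθ.2])
  have hcot := mul_le_mul_of_nonneg_right (cos_div_sin_le_inv hθ) (sq_nonneg (a - b))
  rw [one_div_mul_eq_div] at hcot
  have : 0 ≤ 2 * a * b * Real.tan (θ / 2) := by positivity
  rw [hvalue]
  linarith
end

section
/- Let p ∈ (2,4), c₁ > 0, τ > 0, and define g(θ,t) := c₁·θ·((τ − t)^p + θ²)^{−1/p} for θ ≥ 0 and t ∈ [0,τ). Then for all such (θ,t), writing A := (τ − t)^p: ∂²_θg / (1 + (∂_θg)²)^{3/2} = − 2c₁·θ·(3A + (1 − 2/p)·θ²)·(A + θ²)^{1+2/p} / ( p·( (A + θ²)^{2+2/p} + c₁²·(A + (1 − 2/p)·θ²)² )^{3/2} ), and this quantity is ≥ − 6θ / ( c₁²·p·(1 − 2/p)³·(A + θ²)^{1−2/p} ). -/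
open Real Set

/-- First derivative of `z ↦ c z (A + z²)^{-1/p}`. -/
lemma hasDerivAt_profile {p c A : ℝ} (hA : 0 < A) (z : ℝ) :
    HasDerivAt (fun z : ℝ => c * z * (A + z ^ 2) ^ (-1/p))
      (c * ((A + z ^ 2) ^ (-1/p - 1) * (A + (1 - 2/p) * z ^ 2))) z := by
  have hD : 0 < A + z ^ 2 := by positivity
  have h1 : HasDerivAt (fun z : ℝ => A + z ^ 2) (2 * z) z := by
    simpa using (hasDerivAt_pow 2 z).const_add A
  have h2 := ((hasDerivAt_id z).const_mul c).mul
    (h1.rpow_const (p := -1/p) (Or.inl hD.ne'))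
  refine h2.congr_deriv ?_
  rw [rpow_sub_one hD.ne']
  simp only [id]
  field_simp
  ring

/-- Derivative of the expression in `hasDerivAt_profile`. -/
lemma hasDerivAt_profile_deriv {p c A : ℝ} (hp : p ≠ 0) (hA : 0 < A) (z : ℝ) :
    HasDerivAt (fun z : ℝ => c * ((A + z ^ 2) ^ (-1/p - 1) * (A + (1 - 2/p) * z ^ 2)))
      (-(2 * c * z * (3 * A + (1 - 2/p) * z ^ 2)) / p *
        ((A + z ^ 2) ^ (-1/p) / (A + z ^ 2) ^ 2)) z := by
  have hD : 0 < A + z ^ 2 := by positivity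
  have h1 : HasDerivAt (fun z : ℝ => A + z ^ 2) (2 * z) z := by
    simpa using (hasDerivAt_pow 2 z).const_add A
  have h3 : HasDerivAt (fun z : ℝ => A + (1 - 2/p) * z ^ 2) ((1 - 2/p) * (2 * z)) z := by
    simpa using ((hasDerivAt_pow 2 z).const_mul (1 - 2/p)).const_add A
  have h2 := ((h1.rpow_const (p := -1/p - 1) (Or.inl hD.ne')).mul h3).const_mul c
  refine h2.congr_deriv ?_
  rw [rpow_sub_one hD.ne', rpow_sub_one hD.ne']
  field_simp
  ring

lemma sq_rpow_three_halves {x : ℝ} (hx : 0 ≤ x) : (x ^ 2) ^ ((3:ℝ)/2) = x ^ 3 := by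
  rw [← rpow_natCast x 2, ← rpow_mul hx, ← rpow_natCast x 3]
  norm_num

/-- **The curvature-term computation and lower bound (LemEq4)** for the blow-up
subsolution profile `g(θ,t) = c₁ θ ((τ-t)^p + θ²)^{-1/p}`, writing `A = (τ-t)^p`. -/
theorem blowup_profile_curvature_term
    (p c₁ τ : ℝ) (hp : p ∈ Ioo (2:ℝ) 4) (hc₁ : 0 < c₁) (hτ : 0 < τ)
    (g : ℝ → ℝ → ℝ)
    (hg : ∀ θ t, g θ t = c₁ * θ * ((τ - t) ^ p + θ ^ 2) ^ (-1/p)) :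
    ∀ θ t, 0 ≤ θ → t ∈ Ico 0 τ →
      deriv (deriv (fun z => g z t)) θ /
          (1 + (deriv (fun z => g z t) θ) ^ 2) ^ ((3:ℝ)/2) =
        -(2 * c₁ * θ * (3 * (τ - t) ^ p + (1 - 2/p) * θ ^ 2) *
            ((τ - t) ^ p + θ ^ 2) ^ (1 + 2/p)) /
          (p * (((τ - t) ^ p + θ ^ 2) ^ (2 + 2/p) +
            c₁ ^ 2 * ((τ - t) ^ p + (1 - 2/p) * θ ^ 2) ^ 2) ^ ((3:ℝ)/2)) ∧
      -(6 * θ) / (c₁ ^ 2 * p * (1 - 2/p) ^ 3 * ((τ - t) ^ p + θ ^ 2) ^ (1 - 2/p)) ≤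
        deriv (deriv (fun z => g z t)) θ /
          (1 + (deriv (fun z => g z t) θ) ^ 2) ^ ((3:ℝ)/2) := by
  intro θ t hθ ht
  obtain ⟨hp2, -⟩ := hp
  have hp0 : 0 < p := by linarith
  have hA : 0 < (τ - t) ^ p := rpow_pos_of_pos (sub_pos.2 ht.2) p
  have hk : 0 < 1 - 2/p := by
    rw [sub_pos, div_lt_one hp0]
    exact hp2
  have hk1 : 1 - 2/p ≤ 1 := by
    have : 0 < 2/p := by positivity
    linarith
  simp only [hg]
  generalize (τ - t) ^ p = A at hA ⊢
  rw [funext fun z => (hasDerivAt_profile (p := p) (c := c₁) hA z).deriv,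
    (hasDerivAt_profile_deriv hp0.ne' hA θ).deriv]
  have hD : 0 < A + θ ^ 2 := by positivity
  have hs : 0 < (A + θ ^ 2) ^ (-1/p) := rpow_pos_of_pos hD _
  have hs2 : (A + θ ^ 2) ^ (2/p) = (((A + θ ^ 2) ^ (-1/p)) ^ 2)⁻¹ := by
    rw [← rpow_natCast (_ ^ (-1/p)), ← rpow_mul hD.le, ← rpow_neg hD.le]
    congr 1
    push_cast
    ring
  beta_reduce
  rw [rpow_sub_one hD.ne', rpow_add hD 1, rpow_add hD 2, rpow_sub hD 1, rpow_one, rpow_two, hs2]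
  have hB : (1 - 2/p) * (A + θ ^ 2) ≤ A + (1 - 2/p) * θ ^ 2 := by nlinarith
  have hN : 3 * A + (1 - 2/p) * θ ^ 2 ≤ 3 * (A + θ ^ 2) := by nlinarith [sq_nonneg θ]
  generalize (A + θ ^ 2) ^ (-1/p) = s at hs ⊢
  generalize hDd : A + θ ^ 2 = D at *
  have hN0 : 0 ≤ 3 * A + (1 - 2/p) * θ ^ 2 := by positivity
  generalize 3 * A + (1 - 2/p) * θ ^ 2 = N at *
  generalize A + (1 - 2/p) * θ ^ 2 = B at *
  generalize 1 - 2/p = k at *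
  have hB0 : 0 < B := lt_of_lt_of_le (by positivity) hB
  have hE : 0 < D ^ 2 * (s ^ 2)⁻¹ + c₁ ^ 2 * B ^ 2 := by positivity
  have hfac : 1 + (c₁ * (s / D * B)) ^ 2 =
      (s / D) ^ 2 * (D ^ 2 * (s ^ 2)⁻¹ + c₁ ^ 2 * B ^ 2) := by
    field_simp
  have hlow : (c₁ * (k * D)) ^ 3 ≤ (D ^ 2 * (s ^ 2)⁻¹ + c₁ ^ 2 * B ^ 2) ^ ((3:ℝ)/2) := by
    rw [← sq_rpow_three_halves (by positivity : 0 ≤ c₁ * (k * D))]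
    refine rpow_le_rpow (by positivity) ?_ (by norm_num)
    have h1 : (k * D) ^ 2 ≤ B ^ 2 := by gcongr
    have h2 : 0 ≤ D ^ 2 * (s ^ 2)⁻¹ := by positivity
    have h3 := mul_le_mul_of_nonneg_left h1 (sq_nonneg c₁)
    linarith [mul_pow c₁ (k * D) 2]
  rw [hfac, mul_rpow (by positivity) hE.le, sq_rpow_three_halves (by positivity)]
  have hF := rpow_pos_of_pos hE ((3:ℝ)/2)
  generalize (D ^ 2 * (s ^ 2)⁻¹ + c₁ ^ 2 * B ^ 2) ^ ((3:ℝ)/2) = F at *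
  have heq : -(2 * c₁ * θ * N) / p * (s / D ^ 2) / ((s / D) ^ 3 * F) =
      -(2 * c₁ * θ * N * (D * (s ^ 2)⁻¹)) / (p * F) := by
    field_simp
  refine ⟨heq, ?_⟩
  rw [heq, neg_div, neg_div, neg_le_neg_iff]
  calc 2 * c₁ * θ * N * (D * (s ^ 2)⁻¹) / (p * F)
      ≤ 2 * c₁ * θ * (3 * D) * (D * (s ^ 2)⁻¹) / (p * (c₁ * (k * D)) ^ 3) := by gcongr
    _ = 6 * θ / (c₁ ^ 2 * p * k ^ 3 * (D / (s ^ 2)⁻¹)) := by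
      field_simp
      ring
end

section
/- Let p ∈ (2,4), c₁ > 0, τ > 0, Θ > 0, and define g(θ,t) := c₁·θ·((τ − t)^p + θ²)^{−1/p}. Then for all θ ∈ [0,Θ] and t ∈ [0,τ), writing A := (τ − t)^p: g·(∂_θg)² / √(1 + (∂_θg)²) = c₁³·θ·(A + (1 − 2/p)·θ²)²·(A + θ²)^{−1−2/p} / ( (A + θ²)^{2+2/p} + c₁²·(A + (1 − 2/p)·θ²)² )^{1/2}, and this quantity is ≥ c₁³·(1 − 2/p)²·θ / ( √( (τ^p + Θ²)^{2/p} + c₁² ) · (A + θ²)^{2/p} ). -/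
open Real Set

/-- The spatial derivative of `c θ (A + θ²)^{-1/p}`. -/
lemma hasDerivAt_mul_rpow_add_sq {p A : ℝ} (c θ : ℝ) (hA : 0 < A) :
    HasDerivAt (fun z => c * z * (A + z ^ 2) ^ (-1 / p))
      (c * (A + (1 - 2 / p) * θ ^ 2) / ((A + θ ^ 2) ^ (1 / p) * (A + θ ^ 2))) θ := by
  have hB : 0 < A + θ ^ 2 := by positivity
  have hs : 0 < (A + θ ^ 2) ^ (1 / p) := rpow_pos_of_pos hB _
  have hbase : HasDerivAt (fun z : ℝ => A + z ^ 2) (2 * θ) θ := by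
    simpa using (hasDerivAt_pow 2 θ).const_add A
  have hpow := hbase.rpow_const (p := -1 / p) (Or.inl hB.ne')
  refine (((hasDerivAt_id θ).const_mul c).mul hpow).congr_deriv ?_
  rw [rpow_sub_one hB.ne', neg_div, rpow_neg hB.le]
  simp only [id]
  field_simp
  ring

lemma sqrt_one_add_div_sq {c M s B : ℝ} (hs : 0 < s) (hB : 0 < B) :
    √(1 + (c * M / (s * B)) ^ 2) = √(B ^ 2 * s ^ 2 + c ^ 2 * M ^ 2) / (s * B) := by
  have h : 1 + (c * M / (s * B)) ^ 2 = (B ^ 2 * s ^ 2 + c ^ 2 * M ^ 2) / (s * B) ^ 2 := by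
    field_simp
  rw [h, sqrt_div' _ (by positivity), sqrt_sq (by positivity)]

lemma le_sq_mul_div_sqrt {c θ κ M s B R : ℝ} (hc : 0 < c) (hθ : 0 ≤ θ) (hκ : 0 < κ)
    (hs : 0 < s) (hB : 0 < B) (hκM : κ * B ≤ M) (hMB : M ≤ B) (hR : s ^ 2 ≤ R) :
    c ^ 3 * κ ^ 2 * θ / (√(R + c ^ 2) * s ^ 2) ≤
      c ^ 3 * θ * M ^ 2 * (B * s ^ 2)⁻¹ / √(B ^ 2 * s ^ 2 + c ^ 2 * M ^ 2) := by
  have hM : 0 < M := (mul_pos hκ hB).trans_le hκM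
  have hsqrt : √(B ^ 2 * s ^ 2 + c ^ 2 * M ^ 2) ≤ B * √(R + c ^ 2) := by
    rw [← sqrt_sq hB.le, ← sqrt_mul (sq_nonneg B), sqrt_sq hB.le]
    apply sqrt_le_sqrt
    calc B ^ 2 * s ^ 2 + c ^ 2 * M ^ 2 ≤ B ^ 2 * R + c ^ 2 * B ^ 2 := by gcongr
      _ = B ^ 2 * (R + c ^ 2) := by ring
  have hR' : 0 < √(R + c ^ 2) := sqrt_pos.2 (by nlinarith [sq_nonneg s, sq_pos_of_pos hc])
  calc c ^ 3 * κ ^ 2 * θ / (√(R + c ^ 2) * s ^ 2)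
      = c ^ 3 * θ * (κ * B) ^ 2 * (B * s ^ 2)⁻¹ / (B * √(R + c ^ 2)) := by field_simp
    _ ≤ _ := by gcongr

/-- **The first-order-term computation and lower bound (LemEq5)** for the blow-up
subsolution profile `g(θ,t) = c₁ θ ((τ-t)^p + θ²)^{-1/p}` on `[0,Θ] × [0,τ)`,
writing `A = (τ-t)^p`. -/
theorem blowup_profile_first_order_term
    (p c₁ τ Θ : ℝ) (hp : p ∈ Ioo (2:ℝ) 4) (hc₁ : 0 < c₁) (hτ : 0 < τ) (hΘ : 0 < Θ)
    (g : ℝ → ℝ → ℝ)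
    (hg : ∀ θ t, g θ t = c₁ * θ * ((τ - t) ^ p + θ ^ 2) ^ (-1/p)) :
    ∀ θ t, θ ∈ Icc 0 Θ → t ∈ Ico 0 τ →
      g θ t * (deriv (fun z => g z t) θ) ^ 2 /
          Real.sqrt (1 + (deriv (fun z => g z t) θ) ^ 2) =
        c₁ ^ 3 * θ * ((τ - t) ^ p + (1 - 2/p) * θ ^ 2) ^ 2 *
            ((τ - t) ^ p + θ ^ 2) ^ (-1 - 2/p) /
          (((τ - t) ^ p + θ ^ 2) ^ (2 + 2/p) +
            c₁ ^ 2 * ((τ - t) ^ p + (1 - 2/p) * θ ^ 2) ^ 2) ^ ((1:ℝ)/2) ∧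
      c₁ ^ 3 * (1 - 2/p) ^ 2 * θ /
          (Real.sqrt ((τ ^ p + Θ ^ 2) ^ (2/p) + c₁ ^ 2) * ((τ - t) ^ p + θ ^ 2) ^ (2/p)) ≤
        g θ t * (deriv (fun z => g z t) θ) ^ 2 /
          Real.sqrt (1 + (deriv (fun z => g z t) θ) ^ 2) := by
  obtain ⟨hp2, -⟩ := hp
  rintro θ t ⟨hθ0, hθ⟩ ⟨ht0, ht⟩
  have hp0 : 0 < p := by linarith
  have hA : 0 < (τ - t) ^ p := rpow_pos_of_pos (by linarith) _
  have hAτ : (τ - t) ^ p ≤ τ ^ p := rpow_le_rpow (by linarith) (by linarith) hp0.le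
  simp only [hg, (hasDerivAt_mul_rpow_add_sq c₁ θ hA).deriv]
  generalize (τ - t) ^ p = A at *
  have hB : 0 < A + θ ^ 2 := by positivity
  have hs : 0 < (A + θ ^ 2) ^ (1 / p) := rpow_pos_of_pos hB _
  have hs2 : (A + θ ^ 2) ^ (2 / p) = ((A + θ ^ 2) ^ (1 / p)) ^ 2 := by
    rw [← rpow_mul_natCast hB.le]
    congr 1
    push_cast
    ring
  have hneg : (A + θ ^ 2) ^ (-1 / p) = ((A + θ ^ 2) ^ (1 / p))⁻¹ := by
    rw [neg_div, rpow_neg hB.le]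
  have hneg2 : (A + θ ^ 2) ^ (-1 - 2 / p) =
      ((A + θ ^ 2) * ((A + θ ^ 2) ^ (1 / p)) ^ 2)⁻¹ := by
    rw [← hs2, show -1 - 2 / p = -(1 + 2 / p) by ring, rpow_neg hB.le, rpow_one_add' hB.le]
    positivity
  have hpos2 : (A + θ ^ 2) ^ (2 + 2 / p) =
      (A + θ ^ 2) ^ 2 * ((A + θ ^ 2) ^ (1 / p)) ^ 2 := by
    rw [← hs2, rpow_add hB, rpow_two]
  have hR : ((A + θ ^ 2) ^ (1 / p)) ^ 2 ≤ (τ ^ p + Θ ^ 2) ^ (2 / p) := by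
    rw [← hs2]
    gcongr
  have hq : 0 < 2 / p := by positivity
  have hκ : 0 < 1 - 2 / p := by
    rw [sub_pos, div_lt_one hp0]
    exact hp2
  have hκM : (1 - 2 / p) * (A + θ ^ 2) ≤ A + (1 - 2 / p) * θ ^ 2 := by nlinarith
  have hMB : A + (1 - 2 / p) * θ ^ 2 ≤ A + θ ^ 2 := by nlinarith [sq_nonneg θ]
  have hformula := sqrt_one_add_div_sq (c := c₁) (M := A + (1 - 2 / p) * θ ^ 2) hs hB
  rw [← sqrt_eq_rpow, hneg, hneg2, hpos2, hs2, hformula]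
  have hbound := le_sq_mul_div_sqrt hc₁ hθ0 hκ hs hB hκM hMB hR
  refine (fun h => ⟨h, hbound.trans_eq h.symm⟩) ?_
  field_simp
end

section
/- Let J' ⊂ ℝ be a closed interval, ψ : J' → (0,∞) a C¹ function, A > 0, k > 0, and c₂ ∈ ℝ with c₂ ≥ sup_{J'} (1/ψ) + A·max(0, sup_{J'} (−ψ'/ψ²)). Define ζ₂(θ,t) := A·(sin(kθ) − c₂·k²·t). Then at every (θ,t) ∈ ℝ × [0,∞) with ζ₂(θ,t) ∈ J', ∂ₜζ₂ ≤ (1/ψ(ζ₂)) · ∂²_θζ₂ / (1 + (∂_θζ₂)²)^{3/2} + (ψ'(ζ₂)/ψ(ζ₂)²) · (∂_θζ₂)² / √(1 + (∂_θζ₂)²). -/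
open Real Set Filter

/-- A `C¹` function that is positive on a compact interval has `-ψ' / ψ²` bounded above there, even
with the two-sided derivative, which is unconstrained at the endpoints. -/
lemma bddAbove_image_neg_deriv_div_sq {c d : ℝ} {ψ : ℝ → ℝ} (hψ : ContDiffOn ℝ 1 ψ (Icc c d))
    (hψpos : ∀ s ∈ Icc c d, 0 < ψ s) :
    BddAbove ((fun s => -(deriv ψ s) / (ψ s) ^ 2) '' Icc c d) := by
  rcases le_or_gt d c with h | h
  · exact (((Set.subsingleton_Icc_of_ge h).finite).image _).bddAbove
  have hcont : ContinuousOn (fun s => -(derivWithin ψ (Icc c d) s) / (ψ s) ^ 2) (Icc c d) :=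
    (hψ.continuousOn_derivWithin (uniqueDiffOn_Icc h) le_rfl).neg.div (hψ.continuousOn.pow 2)
      fun s hs => (pow_pos (hψpos s hs) 2).ne'
  have hends : BddAbove ((fun s => -(deriv ψ s) / (ψ s) ^ 2) '' {c, d}) :=
    ((Set.toFinite {c, d}).image _).bddAbove
  refine ((isCompact_Icc.bddAbove_image hcont).union hends).mono ?_
  rintro _ ⟨s, hs, rfl⟩
  by_cases hsi : s ∈ Ioo c d
  · refine Or.inl ⟨s, hs, ?_⟩
    simp only [derivWithin_of_mem_nhds (Icc_mem_nhds hsi.1 hsi.2)]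
  · refine Or.inr ⟨s, ?_, rfl⟩
    rcases hs.1.eq_or_lt with h1 | h1
    · exact Or.inl h1.symm
    · rcases hs.2.eq_or_lt with h2 | h2
      · exact Or.inr h2
      · exact absurd ⟨h1, h2⟩ hsi

lemma hasDerivAt_mul_sin_sub (A k b z : ℝ) :
    HasDerivAt (fun z => A * (Real.sin (k * z) - b)) (A * k * Real.cos (k * z)) z := by
  have h := ((((hasDerivAt_id z).const_mul k).sin).sub_const b).const_mul A
  exact h.congr_deriv (by simp only [id, mul_one]; ring)

lemma hasDerivAt_mul_cos (B k z : ℝ) :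
    HasDerivAt (fun z => B * Real.cos (k * z)) (-(B * k * Real.sin (k * z))) z := by
  have h := (((hasDerivAt_id z).const_mul k).cos).const_mul B
  exact h.congr_deriv (by simp only [id, mul_one]; ring)

/-- **The subsolution property of the second barrier `ζ₂`** (Eqs. (LemEq11)–(LemEq14)):
`ζ₂(θ,t) = A (sin(kθ) - c₂ k² t)` is a subsolution of the transformed flow equation at
every point where its value lies in `J'`, provided
`c₂ ≥ sup_{J'} (1/ψ) + A · max(0, sup_{J'} (-ψ'/ψ²))`. -/
theorem second_barrier_is_subsolution
    (c d : ℝ) (J' : Set ℝ) (hJ' : J' = Icc c d)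
    (ψ : ℝ → ℝ) (hψ : ContDiffOn ℝ 1 ψ J') (hψpos : ∀ s ∈ J', 0 < ψ s)
    (A k c₂ : ℝ) (hA : 0 < A) (hk : 0 < k)
    (hc₂ : sSup ((fun s => 1 / ψ s) '' J') +
        A * max 0 (sSup ((fun s => -(deriv ψ s) / (ψ s) ^ 2) '' J')) ≤ c₂)
    (ζ₂ : ℝ → ℝ → ℝ)
    (hζ₂ : ∀ θ t, ζ₂ θ t = A * (Real.sin (k * θ) - c₂ * k ^ 2 * t)) :
    ∀ θ t : ℝ, 0 ≤ t → ζ₂ θ t ∈ J' → SubSolTrans ψ ζ₂ θ t := by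
  intro θ t _ hmem
  subst hJ'
  have hspace : (fun z => ζ₂ z t) = fun z => A * (Real.sin (k * z) - c₂ * k ^ 2 * t) :=
    funext fun z => hζ₂ z t
  have hD : deriv (fun z => ζ₂ z t) = fun z => A * k * Real.cos (k * z) := by
    rw [hspace]
    exact funext fun z => (hasDerivAt_mul_sin_sub A k _ z).deriv
  have hDD : deriv (deriv fun z => ζ₂ z t) θ = -(A * k * k * Real.sin (k * θ)) := by
    rw [hD]
    exact (hasDerivAt_mul_cos (A * k) k θ).deriv
  have hT : deriv (fun s => ζ₂ θ s) t = -(A * k ^ 2 * c₂) := by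
    rw [show (fun s => ζ₂ θ s) = fun s => A * (Real.sin (k * θ) - c₂ * k ^ 2 * s) from
      funext fun s => hζ₂ θ s]
    have h := (((hasDerivAt_id t).const_mul (c₂ * k ^ 2)).const_sub
      (Real.sin (k * θ))).const_mul A
    simp only [id, mul_one] at h
    rw [h.deriv]
    ring
  have hM : 1 / ψ (ζ₂ θ t) ≤ sSup ((fun s => 1 / ψ s) '' Icc c d) :=
    le_csSup (isCompact_Icc.bddAbove_image
      (continuousOn_const.div hψ.continuousOn fun s hs => (hψpos s hs).ne'))
      (mem_image_of_mem _ hmem)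
  have hm : -(deriv ψ (ζ₂ θ t)) / (ψ (ζ₂ θ t)) ^ 2 ≤
      max 0 (sSup ((fun s => -(deriv ψ s) / (ψ s) ^ 2) '' Icc c d)) :=
    (le_csSup (bddAbove_image_neg_deriv_div_sq hψ hψpos)
      (mem_image_of_mem _ hmem)).trans (le_max_right _ _)
  have hpos : 0 < 1 / ψ (ζ₂ θ t) := one_div_pos.2 (hψpos _ hmem)
  have hm0 := le_max_left 0 (sSup ((fun s => -(deriv ψ s) / (ψ s) ^ 2) '' Icc c d))
  unfold SubSolTrans
  rw [hDD, hT, hD]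
  generalize ζ₂ θ t = z at *
  generalize sSup ((fun s => 1 / ψ s) '' Icc c d) = M at *
  generalize max 0 (sSup ((fun s => -(deriv ψ s) / (ψ s) ^ 2) '' Icc c d)) = m at *
  set p := A * k * Real.cos (k * θ) with hp
  have hp2 : p ^ 2 ≤ A ^ 2 * k ^ 2 := by
    rw [hp, mul_pow, mul_pow]
    exact mul_le_of_le_one_right (by positivity) (Real.cos_sq_le_one _)
  have h1 : 1 ≤ (1 + p ^ 2) ^ ((3 : ℝ) / 2) :=
    Real.one_le_rpow (by nlinarith [sq_nonneg p]) (by norm_num)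
  have h2 : 1 ≤ Real.sqrt (1 + p ^ 2) := Real.one_le_sqrt.2 (by nlinarith [sq_nonneg p])
  have hAk : 0 < A * k ^ 2 := by positivity
  have hfirst : 1 / ψ z * (A * k * k * Real.sin (k * θ) / (1 + p ^ 2) ^ ((3 : ℝ) / 2)) ≤
      M * (A * k ^ 2) := by
    refine (mul_le_mul_of_nonneg_left ?_ hpos.le).trans (mul_le_mul_of_nonneg_right hM hAk.le)
    rw [div_le_iff₀ (by positivity)]
    nlinarith [mul_le_mul_of_nonneg_left (Real.sin_le_one (k * θ)) hAk.le,
      mul_le_mul_of_nonneg_left h1 hAk.le]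
  have hsecond : -(deriv ψ z) / ψ z ^ 2 * (p ^ 2 / Real.sqrt (1 + p ^ 2)) ≤
      m * (A ^ 2 * k ^ 2) := by
    refine (mul_le_mul_of_nonneg_right hm (by positivity)).trans
      (mul_le_mul_of_nonneg_left ?_ hm0)
    exact (div_le_self (sq_nonneg p) h2).trans hp2
  have hc := mul_le_mul_of_nonneg_left hc₂ hAk.le
  rw [neg_div, neg_mul] at hsecond
  rw [neg_div, mul_neg]
  linarith
end

section
/- Let ψ : ℝ → (0,∞) be a smooth even function, let k be a positive integer, T > 0, and let γ̃ : [0,π/k] × [0,T) → ℝ be a smooth solution of the transformed flow equation with γ̃(0,t) = γ̃(π/k, t) = 0 for all t ∈ [0,T). Define γ : ℝ × [0,T) → ℝ by γ(θ,t) := γ̃(θ − jπ/k, t) if θ ∈ [jπ/k, (j+1)π/k) with j ∈ ℤ even, and γ(θ,t) := −γ̃((j+1)π/k − θ, t) if θ ∈ [jπ/k, (j+1)π/k) with j ∈ ℤ odd. Then γ is smooth on ℝ × [0,T), 2π-periodic in its first variable, and solves the transformed flow equation on ℝ × [0,T). -/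
open Real Set Filter

/-- The half-open space-time rectangle `[0, L] × [0, T)`. -/
def spaceTime (L T : ℝ) : Set (ℝ × ℝ) := Icc 0 L ×ˢ Ico 0 T

/-- The partial derivative in space, taken within `[0, L] × [0, T)`. -/
noncomputable def spaceDeriv (L T : ℝ) (f : ℝ × ℝ → ℝ) (p : ℝ × ℝ) : ℝ :=
  fderivWithin ℝ f (spaceTime L T) p (1, 0)

/-- The partial derivative in time, taken within `[0, L] × [0, T)`. -/
noncomputable def timeDeriv (L T : ℝ) (f : ℝ × ℝ → ℝ) (p : ℝ × ℝ) : ℝ :=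
  fderivWithin ℝ f (spaceTime L T) p (0, 1)

/-- The extension of `f` from `[0, L]` to `ℝ` in the space variable by repeated reflection with
parity `ε`: even for `ε = 1`, odd for `ε = -1`. -/
noncomputable def reflect (L ε : ℝ) (f : ℝ × ℝ → ℝ) (p : ℝ × ℝ) : ℝ :=
  if Even ⌊p.1 / L⌋ then f (p.1 - ⌊p.1 / L⌋ * L, p.2)
  else ε * f ((⌊p.1 / L⌋ + 1) * L - p.1, p.2)

/-- The boundary values of `f` are compatible with reflection of parity `ε`. -/
def Compat (L T ε : ℝ) (f : ℝ × ℝ → ℝ) : Prop :=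
  ∀ t ∈ Ico 0 T, ε * f (0, t) = f (0, t) ∧ ε * f (L, t) = f (L, t)

/-- The space derivatives of `f` of order at most `n` are compatible with reflection. -/
def CompatUpTo (L T : ℝ) : ℕ → ℝ → (ℝ × ℝ → ℝ) → Prop
  | 0, ε, f => Compat L T ε f
  | n + 1, ε, f => Compat L T ε f ∧ CompatUpTo L T n (-ε) (spaceDeriv L T f)

/-- The `j`-th cell `[jL, (j+1)L]`. -/
def cell (L : ℝ) (j : ℤ) : Set ℝ := Icc (j * L) ((j + 1) * L)

section Calculus

variable {L T : ℝ} {f g : ℝ × ℝ → ℝ}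

theorem interior_spaceTime : interior (spaceTime L T) = Ioo 0 L ×ˢ Ioo 0 T := by
  rw [spaceTime, interior_prod_eq, interior_Icc, interior_Ico]

theorem convex_spaceTime : Convex ℝ (spaceTime L T) :=
  (convex_Icc 0 L).prod (convex_Ico 0 T)

theorem interior_spaceTime_nonempty (hL : 0 < L) (hT : 0 < T) :
    (interior (spaceTime L T)).Nonempty := by
  rw [interior_spaceTime]
  exact (nonempty_Ioo.2 hL).prod (nonempty_Ioo.2 hT)

theorem uniqueDiffOn_spaceTime (hL : 0 < L) (hT : 0 < T) :
    UniqueDiffOn ℝ (spaceTime L T) :=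
  uniqueDiffOn_convex convex_spaceTime (interior_spaceTime_nonempty hL hT)

theorem spaceTime_subset_closure_interior (hL : 0 < L) (hT : 0 < T) :
    spaceTime L T ⊆ closure (interior (spaceTime L T)) := by
  rw [convex_spaceTime.closure_interior_eq_closure_of_nonempty_interior
    (interior_spaceTime_nonempty hL hT)]
  exact subset_closure

theorem ContDiffOn.fderivWithin_spaceTime (hL : 0 < L) (hT : 0 < T)
    (hf : ContDiffOn ℝ (⊤ : ℕ∞) f (spaceTime L T)) :
    ContDiffOn ℝ (⊤ : ℕ∞) (fderivWithin ℝ f (spaceTime L T)) (spaceTime L T) :=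
  hf.fderivWithin (uniqueDiffOn_spaceTime hL hT) (by simp)

protected theorem ContDiffOn.spaceDeriv (hL : 0 < L) (hT : 0 < T)
    (hf : ContDiffOn ℝ (⊤ : ℕ∞) f (spaceTime L T)) :
    ContDiffOn ℝ (⊤ : ℕ∞) (spaceDeriv L T f) (spaceTime L T) :=
  (hf.fderivWithin_spaceTime hL hT).clm_apply contDiffOn_const

protected theorem ContDiffOn.timeDeriv (hL : 0 < L) (hT : 0 < T)
    (hf : ContDiffOn ℝ (⊤ : ℕ∞) f (spaceTime L T)) :
    ContDiffOn ℝ (⊤ : ℕ∞) (timeDeriv L T f) (spaceTime L T) :=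
  (hf.fderivWithin_spaceTime hL hT).clm_apply contDiffOn_const

theorem ContDiffOn.hasFDerivWithinAt_spaceTime
    (hf : ContDiffOn ℝ (⊤ : ℕ∞) f (spaceTime L T)) {p : ℝ × ℝ} (hp : p ∈ spaceTime L T) :
    HasFDerivWithinAt f (spaceDeriv L T f p • ContinuousLinearMap.fst ℝ ℝ ℝ +
      timeDeriv L T f p • ContinuousLinearMap.snd ℝ ℝ ℝ) (spaceTime L T) p := by
  refine ((hf.differentiableOn (by simp)) p hp).hasFDerivWithinAt.congr_fderiv ?_
  ext <;> simp [spaceDeriv, timeDeriv]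

theorem ContDiffOn.hasDerivWithinAt_space
    (hf : ContDiffOn ℝ (⊤ : ℕ∞) f (spaceTime L T)) {x t : ℝ} (hx : x ∈ Icc 0 L)
    (ht : t ∈ Ico 0 T) :
    HasDerivWithinAt (fun y => f (y, t)) (spaceDeriv L T f (x, t)) (Icc 0 L) x := by
  have h := (hf.hasFDerivWithinAt_spaceTime (p := (x, t)) ⟨hx, ht⟩).comp_hasDerivWithinAt_of_eq x
    ((hasDerivWithinAt_id x (Icc 0 L)).prodMk (hasDerivWithinAt_const x (Icc 0 L) t))
    (fun y hy => ⟨hy, ht⟩) rfl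
  simpa [Function.comp_def] using h

theorem ContDiffOn.hasDerivWithinAt_time
    (hf : ContDiffOn ℝ (⊤ : ℕ∞) f (spaceTime L T)) {x t : ℝ} (hx : x ∈ Icc 0 L)
    (ht : t ∈ Ico 0 T) :
    HasDerivWithinAt (fun s => f (x, s)) (timeDeriv L T f (x, t)) (Ico 0 T) t := by
  have h := (hf.hasFDerivWithinAt_spaceTime (p := (x, t)) ⟨hx, ht⟩).comp_hasDerivWithinAt_of_eq t
    ((hasDerivWithinAt_const t (Ico 0 T) x).prodMk (hasDerivWithinAt_id t (Ico 0 T)))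
    (fun y hy => ⟨hx, hy⟩) rfl
  simpa [Function.comp_def] using h

theorem spaceDeriv_timeDeriv (hL : 0 < L) (hT : 0 < T)
    (hf : ContDiffOn ℝ (⊤ : ℕ∞) f (spaceTime L T)) :
    EqOn (spaceDeriv L T (timeDeriv L T f)) (timeDeriv L T (spaceDeriv L T f))
      (spaceTime L T) := by
  intro p hp
  have hs := uniqueDiffOn_spaceTime hL hT
  have hd := ((hf.fderivWithin_spaceTime hL hT).differentiableOn (by simp)) p hp
  have key : ∀ v w : ℝ × ℝ,
      fderivWithin ℝ (fun q => fderivWithin ℝ f (spaceTime L T) q v) (spaceTime L T) p w =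
        fderivWithin ℝ (fderivWithin ℝ f (spaceTime L T)) (spaceTime L T) p w v := by
    intro v w
    rw [fderivWithin_clm_apply (hs p hp) hd (differentiableWithinAt_const v)]
    simp
  have hsymm : IsSymmSndFDerivWithinAt ℝ f (spaceTime L T) p :=
    (hf p hp).isSymmSndFDerivWithinAt (by
      rw [minSmoothness_of_isRCLikeNormedField]; exact WithTop.coe_le_coe.2 le_top) hs
      (spaceTime_subset_closure_interior hL hT hp) hp
  exact (key _ _).trans ((hsymm _ _).trans (key _ _).symm)

theorem spaceDeriv_congr (h : EqOn f g (spaceTime L T)) :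
    EqOn (spaceDeriv L T f) (spaceDeriv L T g) (spaceTime L T) := fun p hp => by
  simp only [spaceDeriv, fderivWithin_congr h (h hp)]

theorem Compat.congr {ε : ℝ} (hL : 0 < L) (h : EqOn f g (spaceTime L T))
    (hf : Compat L T ε f) : Compat L T ε g := fun t ht => by
  rw [← h (x := (0, t)) ⟨⟨le_rfl, hL.le⟩, ht⟩, ← h (x := (L, t)) ⟨⟨hL.le, le_rfl⟩, ht⟩]
  exact hf t ht

theorem CompatUpTo.compat {n : ℕ} {ε : ℝ} (hf : CompatUpTo L T n ε f) : Compat L T ε f := by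
  cases n with
  | zero => exact hf
  | succ n => exact hf.1

theorem CompatUpTo.congr (hL : 0 < L) {n : ℕ} {ε : ℝ} (h : EqOn f g (spaceTime L T))
    (hf : CompatUpTo L T n ε f) : CompatUpTo L T n ε g := by
  induction n generalizing ε f g with
  | zero => exact Compat.congr hL h hf
  | succ n ih => exact ⟨hf.1.congr hL h, ih (spaceDeriv_congr h) hf.2⟩

protected theorem Compat.timeDeriv {ε : ℝ} (hL : 0 < L)
    (hf : ContDiffOn ℝ (⊤ : ℕ∞) f (spaceTime L T)) (h : Compat L T ε f) :
    Compat L T ε (timeDeriv L T f) := by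
  have key : ∀ x ∈ Icc 0 L, (∀ t ∈ Ico 0 T, ε * f (x, t) = f (x, t)) → ∀ t ∈ Ico 0 T,
      ε * timeDeriv L T f (x, t) = timeDeriv L T f (x, t) := by
    intro x hx hb t ht
    have h1 := hf.hasDerivWithinAt_time hx ht
    have h2 := (h1.const_mul ε).congr (f₁ := fun s => f (x, s))
      (fun s hs => (hb s hs).symm) (hb t ht).symm
    exact ((uniqueDiffOn_Ico 0 T) t ht).eq_deriv _ h2 h1
  exact fun t ht => ⟨key 0 ⟨le_rfl, hL.le⟩ (fun s hs => (h s hs).1) t ht,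
    key L ⟨hL.le, le_rfl⟩ (fun s hs => (h s hs).2) t ht⟩

protected theorem CompatUpTo.timeDeriv (hL : 0 < L) (hT : 0 < T) {n : ℕ} {ε : ℝ}
    (hf : ContDiffOn ℝ (⊤ : ℕ∞) f (spaceTime L T)) (h : CompatUpTo L T n ε f) :
    CompatUpTo L T n ε (timeDeriv L T f) := by
  induction n generalizing ε f with
  | zero => exact Compat.timeDeriv hL hf h
  | succ n ih =>
    exact ⟨h.1.timeDeriv hL hf, (ih (hf.spaceDeriv hL hT) h.2).congr hL
      (spaceDeriv_timeDeriv hL hT hf).symm⟩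

end Calculus

section Reflection

open scoped Topology

variable {L T ε : ℝ} {f : ℝ × ℝ → ℝ}

theorem mem_cell_floor (hL : 0 < L) (x : ℝ) : x ∈ cell L ⌊x / L⌋ :=
  ⟨(le_div_iff₀ hL).1 (Int.floor_le _), ((div_lt_iff₀ hL).1 (Int.lt_floor_add_one _)).le⟩

theorem floor_eq_or_of_mem_cell (hL : 0 < L) {j : ℤ} {x : ℝ} (hx : x ∈ cell L j) :
    ⌊x / L⌋ = j ∨ ⌊x / L⌋ = j + 1 ∧ x = (j + 1) * L := by
  rcases hx.2.lt_or_eq with h | h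
  · exact .inl (Int.floor_eq_iff.2 ⟨(le_div_iff₀ hL).2 hx.1, (div_lt_iff₀ hL).2 h⟩)
  · refine .inr ⟨?_, h⟩
    rw [h, mul_div_cancel_right₀ _ hL.ne']
    exact_mod_cast Int.floor_intCast (j + 1)

theorem reflect_of_even (hL : 0 < L) (hf : Compat L T ε f) {j : ℤ} (hj : Even j) {x t : ℝ}
    (hx : x ∈ cell L j) (ht : t ∈ Ico 0 T) : reflect L ε f (x, t) = f (x - j * L, t) := by
  rcases floor_eq_or_of_mem_cell hL hx with h | ⟨h, hx'⟩
  · simp [reflect, h, hj]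
  · have : ¬ Even (j + 1) := by simpa [Int.even_add_one] using hj
    simp only [reflect, h, this, if_false]
    push_cast
    rw [show ((j : ℝ) + 1 + 1) * L - x = L by rw [hx']; ring,
      show x - j * L = L by rw [hx']; ring, (hf t ht).2]

theorem reflect_of_not_even (hL : 0 < L) (hf : Compat L T ε f) {j : ℤ} (hj : ¬ Even j) {x t : ℝ}
    (hx : x ∈ cell L j) (ht : t ∈ Ico 0 T) :
    reflect L ε f (x, t) = ε * f ((j + 1) * L - x, t) := by
  rcases floor_eq_or_of_mem_cell hL hx with h | ⟨h, hx'⟩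
  · simp [reflect, h, hj]
  · have : Even (j + 1) := by simpa [Int.even_add_one] using hj
    simp only [reflect, h, this, if_true]
    push_cast
    rw [hx', sub_self, (hf t ht).1]

theorem reflect_of_mem (hL : 0 < L) (hf : Compat L T ε f) {x t : ℝ}
    (hx : x ∈ Icc 0 L) (ht : t ∈ Ico 0 T) : reflect L ε f (x, t) = f (x, t) := by
  simpa using reflect_of_even hL hf (j := 0) (by simp) (by simpa [cell] using hx) ht

theorem reflect_two_mul_sub (hL : 0 < L) (hε : ε * ε = 1) (hf : Compat L T ε f) (i : ℤ) (x : ℝ)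
    {t : ℝ} (ht : t ∈ Ico 0 T) :
    reflect L ε f (2 * (i * L) - x, t) = ε * reflect L ε f (x, t) := by
  have hx := mem_cell_floor hL x
  set j := ⌊x / L⌋
  have hx' : 2 * (i * L) - x ∈ cell L (2 * i - 1 - j) := by
    constructor
    · push_cast; linarith [hx.2]
    · push_cast; linarith [hx.1]
  by_cases hj : Even j
  · have hj' : ¬ Even (2 * i - 1 - j) := by grind
    rw [reflect_of_even hL hf hj hx ht, reflect_of_not_even hL hf hj' hx' ht]
    push_cast
    ring_nf
  · have hj' : Even (2 * i - 1 - j) := by grind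
    rw [reflect_of_not_even hL hf hj hx ht, reflect_of_even hL hf hj' hx' ht, ← mul_assoc ε,
      hε, one_mul]
    push_cast
    ring_nf

theorem exists_cell_union_mem_nhds (hL : 0 < L) (x : ℝ) :
    ∃ i j : ℤ, x ∈ cell L i ∧ x ∈ cell L j ∧ cell L i ∪ cell L j ∈ 𝓝 x := by
  have hx := mem_cell_floor hL x
  have hlt : x < ((⌊x / L⌋ : ℝ) + 1) * L := (div_lt_iff₀ hL).1 (Int.lt_floor_add_one _)
  set j := ⌊x / L⌋
  rcases hx.1.lt_or_eq with h | h
  · exact ⟨j, j, hx, hx, by rw [union_self]; exact Icc_mem_nhds h hlt⟩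
  · refine ⟨j - 1, j, ⟨?_, ?_⟩, hx, ?_⟩
    · push_cast; nlinarith
    · push_cast; linarith
    · have h1 : ((j - 1 : ℤ) : ℝ) * L < x := by push_cast; nlinarith
      refine mem_of_superset (Icc_mem_nhds h1 hlt) fun y hy => ?_
      rcases le_total y (j * L) with hy' | hy'
      · exact .inl ⟨hy.1, by push_cast; linarith⟩
      · exact .inr ⟨hy', hy.2⟩

theorem union_prod_mem_nhdsWithin {s u v : Set ℝ} {p : ℝ × ℝ} (h : u ∪ v ∈ 𝓝 p.1) :
    u ×ˢ s ∪ v ×ˢ s ∈ 𝓝[univ ×ˢ s] p := by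
  rw [← union_prod, nhdsWithin_prod_eq, nhdsWithin_univ]
  exact prod_mem_prod h self_mem_nhdsWithin

theorem continuousOn_reflect (hL : 0 < L) (hc : ContinuousOn f (spaceTime L T))
    (hf : Compat L T ε f) : ContinuousOn (reflect L ε f) (univ ×ˢ Ico 0 T) := by
  have key : ∀ j : ℤ, ContinuousOn (reflect L ε f) (cell L j ×ˢ Ico 0 T) := by
    intro j
    by_cases hj : Even j
    · refine ContinuousOn.congr (f := fun p => f (p.1 - j * L, p.2)) (hc.comp (by fun_prop) ?_)
        fun p hp => reflect_of_even hL hf hj hp.1 hp.2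
      exact fun p hp => ⟨⟨by linarith [hp.1.1], by linarith [hp.1.2]⟩, hp.2⟩
    · refine ContinuousOn.congr (f := fun p => ε * f ((j + 1) * L - p.1, p.2))
        (continuousOn_const.mul (hc.comp (by fun_prop) ?_))
        fun p hp => reflect_of_not_even hL hf hj hp.1 hp.2
      exact fun p hp => ⟨⟨by linarith [hp.1.2], by linarith [hp.1.1]⟩, hp.2⟩
  intro p hp
  obtain ⟨i, j, hi, hj, hij⟩ := exists_cell_union_mem_nhds hL p.1
  exact ((key i p ⟨hi, hp.2⟩).union (key j p ⟨hj, hp.2⟩)).mono_of_mem_nhdsWithin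
    (union_prod_mem_nhdsWithin hij)

theorem hasFDerivWithinAt_reflect (hL : 0 < L) (hs : ContDiffOn ℝ (⊤ : ℕ∞) f (spaceTime L T))
    (hf : Compat L T ε f) (hf' : Compat L T (-ε) (spaceDeriv L T f)) {p : ℝ × ℝ}
    (hp : p ∈ (univ : Set ℝ) ×ˢ Ico 0 T) :
    HasFDerivWithinAt (reflect L ε f)
      (reflect L (-ε) (spaceDeriv L T f) p • ContinuousLinearMap.fst ℝ ℝ ℝ +
        reflect L ε (timeDeriv L T f) p • ContinuousLinearMap.snd ℝ ℝ ℝ)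
      (univ ×ˢ Ico 0 T) p := by
  have hft := hf.timeDeriv hL hs
  have key : ∀ j : ℤ, p.1 ∈ cell L j → HasFDerivWithinAt (reflect L ε f)
      (reflect L (-ε) (spaceDeriv L T f) p • ContinuousLinearMap.fst ℝ ℝ ℝ +
        reflect L ε (timeDeriv L T f) p • ContinuousLinearMap.snd ℝ ℝ ℝ)
      (cell L j ×ˢ Ico 0 T) p := by
    intro j hpj
    by_cases hj : Even j
    · have hmaps : MapsTo (fun q : ℝ × ℝ => (q.1 - j * L, q.2)) (cell L j ×ˢ Ico 0 T)
          (spaceTime L T) :=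
        fun q hq => ⟨⟨by linarith [hq.1.1], by linarith [hq.1.2]⟩, hq.2⟩
      have haff : HasFDerivWithinAt (fun q : ℝ × ℝ => (q.1 - j * L, q.2))
          ((ContinuousLinearMap.fst ℝ ℝ ℝ).prod (ContinuousLinearMap.snd ℝ ℝ ℝ))
          (cell L j ×ˢ Ico 0 T) p :=
        (hasFDerivWithinAt_fst.sub_const _).prodMk hasFDerivWithinAt_snd
      have h := (hs.hasFDerivWithinAt_spaceTime (hmaps ⟨hpj, hp.2⟩)).comp p haff hmaps
      rw [show p = (p.1, p.2) from rfl, reflect_of_even hL hf' hj hpj hp.2,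
        reflect_of_even hL hft hj hpj hp.2]
      refine (h.congr (fun q hq => reflect_of_even hL hf hj hq.1 hq.2)
        (reflect_of_even hL hf hj hpj hp.2)).congr_fderiv ?_
      ext <;> simp
    · have hmaps : MapsTo (fun q : ℝ × ℝ => ((j + 1) * L - q.1, q.2)) (cell L j ×ˢ Ico 0 T)
          (spaceTime L T) :=
        fun q hq => ⟨⟨by linarith [hq.1.2], by linarith [hq.1.1]⟩, hq.2⟩
      have haff : HasFDerivWithinAt (fun q : ℝ × ℝ => ((j + 1) * L - q.1, q.2))
          ((-ContinuousLinearMap.fst ℝ ℝ ℝ).prod (ContinuousLinearMap.snd ℝ ℝ ℝ))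
          (cell L j ×ˢ Ico 0 T) p :=
        (hasFDerivWithinAt_fst.const_sub _).prodMk hasFDerivWithinAt_snd
      have h := ((hs.hasFDerivWithinAt_spaceTime (hmaps ⟨hpj, hp.2⟩)).comp p haff
        hmaps).const_mul ε
      rw [show p = (p.1, p.2) from rfl, reflect_of_not_even hL hf' hj hpj hp.2,
        reflect_of_not_even hL hft hj hpj hp.2]
      refine (h.congr (fun q hq => reflect_of_not_even hL hf hj hq.1 hq.2)
        (reflect_of_not_even hL hf hj hpj hp.2)).congr_fderiv ?_
      ext <;> simp
  obtain ⟨i, j, hi, hj, hij⟩ := exists_cell_union_mem_nhds hL p.1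
  exact ((key i hi).union (key j hj)).mono_of_mem_nhdsWithin (union_prod_mem_nhdsWithin hij)

theorem hasDerivAt_reflect (hL : 0 < L) (hs : ContDiffOn ℝ (⊤ : ℕ∞) f (spaceTime L T))
    (hf : Compat L T ε f) (hf' : Compat L T (-ε) (spaceDeriv L T f)) {t : ℝ}
    (ht : t ∈ Ico 0 T) (x : ℝ) :
    HasDerivAt (fun y => reflect L ε f (y, t)) (reflect L (-ε) (spaceDeriv L T f) (x, t)) x := by
  have h := (hasFDerivWithinAt_reflect hL hs hf hf' (p := (x, t))
    ⟨mem_univ _, ht⟩).comp_hasDerivWithinAt_of_eq x (s := univ)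
    ((hasDerivWithinAt_id x univ).prodMk (hasDerivWithinAt_const x univ t))
    (fun y _ => ⟨mem_univ _, ht⟩) rfl
  simpa [Function.comp_def] using h

theorem CompatUpTo.contDiff_reflect (hL : 0 < L) (hT : 0 < T) {n : ℕ}
    (hs : ContDiffOn ℝ (⊤ : ℕ∞) f (spaceTime L T)) (hf : CompatUpTo L T n ε f) {t : ℝ}
    (ht : t ∈ Ico 0 T) : ContDiff ℝ n (fun x => reflect L ε f (x, t)) := by
  induction n generalizing ε f with
  | zero =>
    rw [Nat.cast_zero, contDiff_zero, ← continuousOn_univ]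
    exact (continuousOn_reflect hL hs.continuousOn hf).comp (by fun_prop)
      fun x _ => ⟨mem_univ _, ht⟩
  | succ n ih =>
    have hd := hasDerivAt_reflect hL hs hf.1 hf.2.compat ht
    rw [Nat.cast_succ, contDiff_succ_iff_deriv]
    refine ⟨fun x => (hd x).differentiableAt, by simp, ?_⟩
    rw [show deriv (fun x => reflect L ε f (x, t)) =
      fun x => reflect L (-ε) (spaceDeriv L T f) (x, t) from funext fun x => (hd x).deriv]
    exact ih (hs.spaceDeriv hL hT) hf.2

theorem deriv_eq_zero_of_forall_two_mul_sub {h : ℝ → ℝ} {c : ℝ}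
    (hh : ∀ x, h (2 * c - x) = h x) : deriv h c = 0 := by
  have h1 := deriv_comp_const_sub (f := h) (2 * c) c
  rw [show (fun x => h (2 * c - x)) = h from funext hh, two_mul, add_sub_cancel_right] at h1
  linarith

/-- Differentiability of an even reflection forces the normal derivative to vanish. -/
theorem compat_spaceDeriv_of_differentiable (hL : 0 < L) (hε : ε = 1 ∨ ε = -1)
    (hs : ContDiffOn ℝ (⊤ : ℕ∞) f (spaceTime L T)) (hf : Compat L T ε f)
    (hd : ∀ t ∈ Ico 0 T, Differentiable ℝ fun x => reflect L ε f (x, t)) :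
    Compat L T (-ε) (spaceDeriv L T f) := by
  rcases hε with rfl | rfl
  · have key : ∀ i : ℤ, (i : ℝ) * L ∈ Icc 0 L → ∀ t ∈ Ico 0 T,
        spaceDeriv L T f (i * L, t) = 0 := by
      intro i hi t ht
      have h1 : deriv (fun x => reflect L 1 f (x, t)) (i * L) = 0 :=
        deriv_eq_zero_of_forall_two_mul_sub fun x => by
          rw [reflect_two_mul_sub hL (by norm_num) hf i x ht, one_mul]
      have h2 := ((hd t ht) (i * L)).hasDerivAt.hasDerivWithinAt (s := Icc 0 L)
      rw [h1] at h2
      have h3 := (hs.hasDerivWithinAt_space hi ht).congr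
        (fun x hx => reflect_of_mem hL hf hx ht) (reflect_of_mem hL hf hi ht)
      exact ((uniqueDiffOn_Icc hL) _ hi).eq_deriv _ h3 h2
    intro t ht
    have h0 := key 0 (by simp [hL.le]) t ht
    have h1 := key 1 (by simp [hL.le]) t ht
    simp only [Int.cast_zero, zero_mul, Int.cast_one, one_mul] at h0 h1
    simp [h0, h1]
  · intro t _
    simp

theorem compatUpTo_of_contDiff_reflect (hL : 0 < L) (hT : 0 < T) (hε : ε = 1 ∨ ε = -1) {n : ℕ}
    (hs : ContDiffOn ℝ (⊤ : ℕ∞) f (spaceTime L T)) (hf : Compat L T ε f)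
    (h : ∀ t ∈ Ico 0 T, ContDiff ℝ n fun x => reflect L ε f (x, t)) :
    CompatUpTo L T n ε f := by
  induction n generalizing ε f with
  | zero => exact hf
  | succ n ih =>
    simp only [Nat.cast_succ, contDiff_succ_iff_deriv] at h
    have hf' := compat_spaceDeriv_of_differentiable hL hε hs hf fun t ht => (h t ht).1
    refine ⟨hf, ih (by rcases hε with rfl | rfl <;> simp) (hs.spaceDeriv hL hT) hf'
      fun t ht => ?_⟩
    have hd := hasDerivAt_reflect hL hs hf hf' ht
    rw [show (fun x => reflect L (-ε) (spaceDeriv L T f) (x, t)) =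
      deriv (fun x => reflect L ε f (x, t)) from funext fun x => (hd x).deriv.symm]
    exact (h t ht).2.2

theorem contDiffOn_reflect (hL : 0 < L) (hT : 0 < T)
    (hs : ContDiffOn ℝ (⊤ : ℕ∞) f (spaceTime L T)) (hf : ∀ n, CompatUpTo L T n ε f) :
    ContDiffOn ℝ (⊤ : ℕ∞) (reflect L ε f) (univ ×ˢ Ico 0 T) := by
  rw [contDiffOn_infty]
  intro n
  induction n generalizing ε f with
  | zero =>
    rw [Nat.cast_zero, contDiffOn_zero]
    exact continuousOn_reflect hL hs.continuousOn (hf 0)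
  | succ n ih =>
    have hx := ih (hs.spaceDeriv hL hT) fun n => (hf (n + 1)).2
    have ht := ih (hs.timeDeriv hL hT) fun n => (hf n).timeDeriv hL hT hs
    rw [Nat.cast_succ, contDiffOn_succ_iff_hasFDerivWithinAt_of_uniqueDiffOn
      (uniqueDiffOn_univ.prod (uniqueDiffOn_Ico 0 T))]
    exact ⟨by simp, fun p => reflect L (-ε) (spaceDeriv L T f) p • ContinuousLinearMap.fst ℝ ℝ ℝ +
      reflect L ε (timeDeriv L T f) p • ContinuousLinearMap.snd ℝ ℝ ℝ,
      (hx.smul contDiffOn_const).add (ht.smul contDiffOn_const), fun p hp =>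
      hasFDerivWithinAt_reflect hL hs (hf 0) (hf 1).2 hp⟩

end Reflection

section Equation

open scoped Topology

variable {ψ : ℝ → ℝ} {L T : ℝ}

/-- The second space derivative `∂²_θγ` prescribed by the transformed flow equation, as a function
of `u = γ`, `p = ∂_θγ` and `w = ∂ₜγ`. -/
noncomputable def sndSpaceDeriv (ψ : ℝ → ℝ) (u p w : ℝ) : ℝ :=
  ψ u * (1 + p ^ 2) ^ ((3 : ℝ) / 2) * w -
    deriv ψ u / ψ u * p ^ 2 * ((1 + p ^ 2) ^ ((3 : ℝ) / 2) / √(1 + p ^ 2))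

theorem deriv_neg_of_even (hψ : ∀ s, ψ (-s) = ψ s) (s : ℝ) : deriv ψ (-s) = -deriv ψ s := by
  have h := deriv_comp_neg ψ s
  rw [show (fun x => ψ (-x)) = ψ from funext hψ] at h
  linarith

theorem sndSpaceDeriv_parity (hψ : ∀ s, ψ (-s) = ψ s) {ε : ℝ} (hε : ε = 1 ∨ ε = -1)
    (u p w : ℝ) : sndSpaceDeriv ψ (ε * u) p (ε * w) = ε * sndSpaceDeriv ψ u p w := by
  rcases hε with rfl | rfl
  · simp
  · simp only [sndSpaceDeriv, neg_one_mul, hψ, deriv_neg_of_even hψ]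
    ring

theorem ContDiffOn.sndSpaceDeriv {E : Type*} [NormedAddCommGroup E] [NormedSpace ℝ E] {n : ℕ}
    {s : Set E} (hψ : ContDiff ℝ (⊤ : ℕ∞) ψ) (hpos : ∀ x, 0 < ψ x) {u p w : E → ℝ}
    (hu : ContDiffOn ℝ n u s) (hp : ContDiffOn ℝ n p s) (hw : ContDiffOn ℝ n w s) :
    ContDiffOn ℝ n (fun x => sndSpaceDeriv ψ (u x) (p x) (w x)) s := by
  have hq : ContDiffOn ℝ n (fun x => 1 + p x ^ 2) s := contDiffOn_const.add (hp.pow 2)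
  have hq0 : ∀ x, 1 + p x ^ 2 ≠ 0 := fun x => by positivity
  have hψn : ContDiff ℝ n ψ := hψ.of_le (by exact_mod_cast le_top)
  have hψ' : ContDiff ℝ n (deriv ψ) :=
    (hψ.iterate_deriv 1).of_le (by exact_mod_cast le_top)
  have hA : ContDiffOn ℝ n (fun x => (1 + p x ^ 2) ^ ((3 : ℝ) / 2)) s :=
    hq.rpow_const_of_ne fun x _ => hq0 x
  have hψu := hψn.comp_contDiffOn hu
  exact ((hψu.mul hA).mul hw).sub ((((hψ'.comp_contDiffOn hu).div hψu
    fun x _ => (hpos _).ne').mul (hp.pow 2)).mul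
    (hA.div (hq.sqrt fun x _ => hq0 x) fun x _ => by positivity))

theorem eq_sndSpaceDeriv (hpos : ∀ x, 0 < ψ x) {u p w r : ℝ}
    (h : w = (1 / ψ u) * (r / (1 + p ^ 2) ^ ((3 : ℝ) / 2)) +
      (deriv ψ u / (ψ u) ^ 2) * (p ^ 2 / √(1 + p ^ 2))) :
    r = sndSpaceDeriv ψ u p w := by
  have hψ := (hpos u).ne'
  have hA : (1 + p ^ 2) ^ ((3 : ℝ) / 2) ≠ 0 := by positivity
  have hB : √(1 + p ^ 2) ≠ 0 := by positivity
  rw [h, sndSpaceDeriv]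
  generalize (1 + p ^ 2) ^ ((3 : ℝ) / 2) = A at *
  generalize √(1 + p ^ 2) = B at *
  field_simp
  ring

theorem spaceDeriv_spaceDeriv_eq (hL : 0 < L) (hT : 0 < T) (hψ : ContDiff ℝ (⊤ : ℕ∞) ψ)
    (hpos : ∀ x, 0 < ψ x) {u : ℝ → ℝ → ℝ}
    (hu : ContDiffOn ℝ (⊤ : ℕ∞) (Function.uncurry u) (spaceTime L T))
    (heq : ∀ x ∈ Icc 0 L, ∀ t ∈ Ico 0 T, SolvesTrans ψ u x t) :
    EqOn (spaceDeriv L T (spaceDeriv L T (Function.uncurry u)))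
      (fun q => sndSpaceDeriv ψ (Function.uncurry u q)
        (spaceDeriv L T (Function.uncurry u) q) (timeDeriv L T (Function.uncurry u) q))
      (spaceTime L T) := by
  have hux := hu.spaceDeriv hL hT
  have hG : ContinuousOn (fun q => sndSpaceDeriv ψ (Function.uncurry u q)
      (spaceDeriv L T (Function.uncurry u) q) (timeDeriv L T (Function.uncurry u) q))
      (spaceTime L T) :=
    (ContDiffOn.sndSpaceDeriv (n := 0) hψ hpos (hu.of_le (by simp)) (hux.of_le (by simp))
      ((hu.timeDeriv hL hT).of_le (by simp))).continuousOn
  refine EqOn.of_subset_closure ?_ (hux.spaceDeriv hL hT).continuousOn hG interior_subset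
    (spaceTime_subset_closure_interior hL hT)
  rw [interior_spaceTime]
  rintro ⟨x, t⟩ ⟨hx, ht⟩
  have ht' := Ioo_subset_Ico_self ht
  have hspace : ∀ {f : ℝ × ℝ → ℝ}, ContDiffOn ℝ (⊤ : ℕ∞) f (spaceTime L T) → ∀ y ∈ Ioo 0 L,
      deriv (fun z => f (z, t)) y = spaceDeriv L T f (y, t) := fun hf y hy =>
    ((hf.hasDerivWithinAt_space (Ioo_subset_Icc_self hy) ht').hasDerivAt
      (Icc_mem_nhds hy.1 hy.2)).deriv
  have htime : deriv (fun s => u x s) t = timeDeriv L T (Function.uncurry u) (x, t) :=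
    ((hu.hasDerivWithinAt_time (Ioo_subset_Icc_self hx) ht').hasDerivAt
      (Ico_mem_nhds ht.1 ht.2)).deriv
  have h1 : ∀ y ∈ Ioo 0 L, deriv (fun z => u z t) y =
      spaceDeriv L T (Function.uncurry u) (y, t) := hspace hu
  have h2 : deriv (deriv fun z => u z t) x =
      spaceDeriv L T (spaceDeriv L T (Function.uncurry u)) (x, t) := by
    rw [← hspace hux x hx]
    exact Filter.EventuallyEq.deriv_eq (mem_of_superset (Ioo_mem_nhds hx.1 hx.2) h1)
  have h := heq x (Ioo_subset_Icc_self hx) t ht'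
  rw [SolvesTrans, htime, h1 x hx, h2] at h
  exact eq_sndSpaceDeriv hpos h

theorem compat_one (L T : ℝ) (f : ℝ × ℝ → ℝ) : Compat L T 1 f := fun t _ => by simp

theorem compatUpTo_of_solvesTrans (hL : 0 < L) (hT : 0 < T) (hψ : ContDiff ℝ (⊤ : ℕ∞) ψ)
    (hpos : ∀ x, 0 < ψ x) (heven : ∀ s, ψ (-s) = ψ s) {u : ℝ → ℝ → ℝ}
    (hu : ContDiffOn ℝ (⊤ : ℕ∞) (Function.uncurry u) (spaceTime L T))
    (heq : ∀ x ∈ Icc 0 L, ∀ t ∈ Ico 0 T, SolvesTrans ψ u x t)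
    (hbc : Compat L T (-1) (Function.uncurry u)) (n : ℕ) :
    CompatUpTo L T n (-1) (Function.uncurry u) ∧
      CompatUpTo L T n 1 (spaceDeriv L T (Function.uncurry u)) := by
  have hux := hu.spaceDeriv hL hT
  have hut := hu.timeDeriv hL hT
  have hpde := spaceDeriv_spaceDeriv_eq hL hT hψ hpos hu heq
  have hbct := hbc.timeDeriv hL hu
  have hbcxx : Compat L T (-1) (spaceDeriv L T (spaceDeriv L T (Function.uncurry u))) := by
    refine Compat.congr hL hpde.symm fun t ht => ?_
    simp only [← sndSpaceDeriv_parity heven (.inr rfl), (hbc t ht).1, (hbc t ht).2,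
      (hbct t ht).1, (hbct t ht).2, and_self]
  induction n with
  | zero => exact ⟨hbc, compat_one L T _⟩
  | succ n ih =>
    refine ⟨⟨hbc, by rw [neg_neg]; exact ih.2⟩, compat_one L T _,
      compatUpTo_of_contDiff_reflect hL hT (.inr rfl) (hux.spaceDeriv hL hT) hbcxx
        fun t ht => ?_⟩
    have hG := ContDiffOn.sndSpaceDeriv hψ hpos
      (ih.1.contDiff_reflect hL hT hu ht).contDiffOn
      (ih.2.contDiff_reflect hL hT hux ht).contDiffOn
      ((ih.1.timeDeriv hL hT hu).contDiff_reflect hL hT hut ht).contDiffOn (s := univ)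
    rw [contDiffOn_univ] at hG
    convert hG using 2 with x
    have hx := mem_cell_floor hL x
    by_cases hj : Even ⌊x / L⌋
    · simp only [reflect_of_even hL hbcxx hj hx ht, reflect_of_even hL hbc hj hx ht,
        reflect_of_even hL hbct hj hx ht, reflect_of_even hL (compat_one L T _) hj hx ht]
      exact hpde ⟨⟨by linarith [hx.1], by linarith [hx.2]⟩, ht⟩
    · simp only [reflect_of_not_even hL hbcxx hj hx ht, reflect_of_not_even hL hbc hj hx ht,
        reflect_of_not_even hL hbct hj hx ht,
        reflect_of_not_even hL (compat_one L T _) hj hx ht, one_mul]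
      rw [sndSpaceDeriv_parity heven (.inr rfl)]
      congr 1
      exact hpde ⟨⟨by linarith [hx.2], by linarith [hx.1]⟩, ht⟩

theorem reflect_add_two_mul_nat (hL : 0 < L) (ε : ℝ) (f : ℝ × ℝ → ℝ) (k : ℕ) (x t : ℝ) :
    reflect L ε f (x + 2 * (k * L), t) = reflect L ε f (x, t) := by
  have h : (x + 2 * (k * L)) / L = x / L + ((2 * k : ℤ) : ℝ) := by
    push_cast
    field_simp
  have he : Even (⌊x / L⌋ + 2 * (k : ℤ)) ↔ Even ⌊x / L⌋ := by grind
  simp only [reflect, h, Int.floor_add_intCast, he]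
  push_cast
  ring_nf

theorem SolvesTrans.congr {u v : ℝ → ℝ → ℝ} {x t : ℝ} (h : SolvesTrans ψ u x t)
    (ht : v x = u x) (hx : (fun z => v z t) =ᶠ[𝓝 x] fun z => u z t) : SolvesTrans ψ v x t := by
  rw [SolvesTrans, hx.deriv.deriv_eq, hx.deriv_eq, ht]
  exact h

theorem SolvesTrans.comp_sub_const {u : ℝ → ℝ → ℝ} {x t c : ℝ}
    (h : SolvesTrans ψ u (x - c) t) : SolvesTrans ψ (fun z => u (z - c)) x t := by
  have h1 : deriv (fun z => u (z - c) t) = fun z => deriv (fun y => u y t) (z - c) :=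
    funext fun z => deriv_comp_sub_const (f := fun y => u y t) c z
  rw [SolvesTrans, h1, deriv_comp_sub_const (f := deriv fun y => u y t)]
  exact h

theorem SolvesTrans.neg_comp_const_sub (heven : ∀ s, ψ (-s) = ψ s) {u : ℝ → ℝ → ℝ} {x t c : ℝ}
    (h : SolvesTrans ψ u (c - x) t) : SolvesTrans ψ (fun z s => -u (c - z) s) x t := by
  have h1 : deriv (fun z => -u (c - z) t) = fun z => deriv (fun y => u y t) (c - z) := by
    funext z
    rw [deriv.fun_neg, deriv_comp_const_sub (f := fun y => u y t), neg_neg]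
  rw [SolvesTrans, h1, deriv_comp_const_sub (f := deriv fun y => u y t), deriv.fun_neg, heven,
    deriv_neg_of_even heven]
  rw [SolvesTrans] at h
  rw [h]
  ring

theorem deriv_eq_zero_of_eqOn_Ico {h : ℝ → ℝ} (h0 : ∀ s ∈ Ico 0 T, h s = 0) {t : ℝ}
    (ht : t ∈ Ico 0 T) : deriv h t = 0 := by
  by_cases hd : DifferentiableAt ℝ h t
  · exact ((uniqueDiffOn_Ico 0 T) t ht).eq_deriv _ hd.hasDerivAt.hasDerivWithinAt
      ((hasDerivWithinAt_const t (Ico 0 T) (0 : ℝ)).congr h0 (h0 t ht))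
  · exact deriv_zero_of_not_differentiableAt hd

/-- Both sides of the transformed flow equation vanish at a centre of odd symmetry. -/
theorem solvesTrans_of_odd (heven : ∀ s, ψ (-s) = ψ s) {v : ℝ → ℝ → ℝ} {c t : ℝ}
    (ht : t ∈ Ico 0 T) (h0 : ∀ s ∈ Ico 0 T, v c s = 0)
    (hodd : ∀ x, v (2 * c - x) t = -v x t) : SolvesTrans ψ v c t := by
  have h1 : ∀ x, deriv (fun z => v z t) (2 * c - x) = deriv (fun z => v z t) x := by
    intro x
    have h := deriv_comp_const_sub (f := fun z => v z t) (2 * c) x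
    simp only [hodd, deriv.fun_neg] at h
    linarith
  have h2 : deriv ψ 0 = 0 := by
    have := deriv_neg_of_even heven 0
    rw [neg_zero] at this
    linarith
  rw [SolvesTrans, deriv_eq_zero_of_eqOn_Ico h0 ht, deriv_eq_zero_of_forall_two_mul_sub h1,
    h0 t ht, h2]
  simp

theorem solvesTrans_reflect (hL : 0 < L) (heven : ∀ s, ψ (-s) = ψ s) {u : ℝ → ℝ → ℝ}
    (heq : ∀ x ∈ Icc 0 L, ∀ t ∈ Ico 0 T, SolvesTrans ψ u x t)
    (hbc : Compat L T (-1) (Function.uncurry u)) (x : ℝ) {t : ℝ} (ht : t ∈ Ico 0 T) :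
    SolvesTrans ψ (fun y s => reflect L (-1) (Function.uncurry u) (y, s)) x t := by
  have hx := mem_cell_floor hL x
  have hlt : x < ((⌊x / L⌋ : ℝ) + 1) * L := (div_lt_iff₀ hL).1 (Int.lt_floor_add_one _)
  set j := ⌊x / L⌋ with hjdef
  rcases hx.1.lt_or_eq with hgt | hxj
  · have hev : ∀ᶠ y in 𝓝 x, y ∈ cell L j := Icc_mem_nhds hgt hlt
    by_cases hj : Even j
    · refine ((heq (x - j * L) ⟨by linarith [hx.1], by linarith [hx.2]⟩ t
        ht).comp_sub_const).congr ?_ (hev.mono fun y hy => reflect_of_even hL hbc hj hy ht)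
      funext s
      simp [reflect, ← hjdef, hj]
    · refine ((heq ((j + 1) * L - x) ⟨by linarith [hx.2], by linarith [hx.1]⟩ t
        ht).neg_comp_const_sub heven).congr ?_ (hev.mono fun y hy => ?_)
      · funext s
        simp [reflect, ← hjdef, hj]
      · simpa using reflect_of_not_even hL hbc hj hy ht
  · have hodd := fun {s : ℝ} (hs : s ∈ Ico 0 T) (y : ℝ) =>
      reflect_two_mul_sub hL (by norm_num) hbc j y hs
    rw [hxj] at hodd
    refine solvesTrans_of_odd heven ht (fun s hs => ?_) fun y => by simpa using hodd ht y
    have := hodd hs x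
    rw [two_mul, add_sub_cancel_right] at this
    linarith

end Equation

/-- **Odd periodic reflection of a Dirichlet solution** (the extension step in the proof of
Theorem 2): since `ψ` is even, the odd `2π/k`-antiperiodic extension of a solution `γ̃` of
the transformed flow equation on `[0, π/k]` with zero boundary values is a smooth,
`2π`-periodic solution on all of `ℝ`. -/
theorem odd_reflection_extends_solution
    (ψ : ℝ → ℝ) (hψsmooth : ContDiff ℝ (⊤ : ℕ∞) ψ) (hψpos : ∀ s, 0 < ψ s)
    (hψeven : ∀ s, ψ (-s) = ψ s)
    (k : ℕ) (hk : 0 < k) (T : ℝ) (hT : 0 < T)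
    (γt : ℝ → ℝ → ℝ)
    (hγtsmooth : ContDiffOn ℝ (⊤ : ℕ∞) (Function.uncurry γt) (Icc 0 (π/(k:ℝ)) ×ˢ Ico 0 T))
    (hγteq : ∀ θ ∈ Icc 0 (π/(k:ℝ)), ∀ t ∈ Ico 0 T, SolvesTrans ψ γt θ t)
    (hbc : ∀ t ∈ Ico 0 T, γt 0 t = 0 ∧ γt (π/(k:ℝ)) t = 0)
    (γ : ℝ → ℝ → ℝ)
    (hγ : ∀ θ t, γ θ t =
      if Even ⌊θ * (k:ℝ) / π⌋ then
        γt (θ - (⌊θ * (k:ℝ) / π⌋ : ℝ) * (π/(k:ℝ))) t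
      else
        -γt (((⌊θ * (k:ℝ) / π⌋ : ℝ) + 1) * (π/(k:ℝ)) - θ) t) :
    ContDiffOn ℝ (⊤ : ℕ∞) (Function.uncurry γ) (univ ×ˢ Ico 0 T) ∧
    (∀ θ t, γ (θ + 2 * π) t = γ θ t) ∧
    (∀ θ t, t ∈ Ico 0 T → SolvesTrans ψ γ θ t) := by
  have hk' : (0 : ℝ) < k := Nat.cast_pos.2 hk
  have hL : 0 < π / (k : ℝ) := div_pos pi_pos hk'
  have hγ' : ∀ θ t, γ θ t = reflect (π / k) (-1) (Function.uncurry γt) (θ, t) := fun θ t => by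
    simp [hγ, reflect, div_div_eq_mul_div]
  obtain rfl : γ = fun θ t => reflect (π / k) (-1) (Function.uncurry γt) (θ, t) :=
    funext fun θ => funext fun t => hγ' θ t
  have hcompat : Compat (π / k) T (-1) (Function.uncurry γt) := fun t ht => by
    simp [(hbc t ht).1, (hbc t ht).2]
  refine ⟨contDiffOn_reflect hL hT hγtsmooth fun n => (compatUpTo_of_solvesTrans hL hT hψsmooth
    hψpos hψeven hγtsmooth hγteq hcompat n).1, fun θ t => ?_, fun θ t ht =>
    solvesTrans_reflect hL hψeven hγteq hcompat θ ht⟩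
  have h := reflect_add_two_mul_nat hL (-1) (Function.uncurry γt) k θ t
  rwa [mul_div_cancel₀ _ hk'.ne'] at h
end

section
/- Let ψ : ℝ → (0,∞) be C¹, L > 0, τ > 0, and let ζ₁, ζ₂ : [0,L] × [0,τ) → ℝ be C² functions each satisfying pointwise ∂ₜζᵢ ≤ (1/ψ(ζᵢ)) · ∂²_θζᵢ / (1 + (∂_θζᵢ)²)^{3/2} + (ψ'(ζᵢ)/ψ(ζᵢ)²) · (∂_θζᵢ)² / √(1 + (∂_θζᵢ)²). Set ζ := max(ζ₁, ζ₂); ζ is locally Lipschitz, hence its partial derivatives ∂ₜζ and ∂_θζ exist almost everywhere. Then ζ is a weak subsolution: for every τ' ∈ (0,τ) and every C¹ function η : [0,L] × [0,τ'] → [0,∞) with η(0,t) = η(L,t) = 0 for all t, one has ∫₀^{τ'} ∫₀^L ( η·∂ₜζ + (1/ψ(ζ)) · ∂_θζ·∂_θη / √(1 + (∂_θζ)²) − 2·(ψ'(ζ)/ψ(ζ)²) · (∂_θζ)²·η / √(1 + (∂_θζ)²) ) dθ dt ≤ 0. -/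
open Real Set Filter

open MeasureTheory Topology

/-- A differentiable function has only countably many zeros with nonzero derivative. -/
lemma countable_zeros_of_hasDerivAt_ne_zero {f f' : ℝ → ℝ} {s : Set ℝ}
    (hf : ∀ x ∈ s, HasDerivAt f (f' x) x) :
    {x ∈ s | f x = 0 ∧ f' x ≠ 0}.Countable := by
  set N := {x ∈ s | f x = 0 ∧ f' x ≠ 0}
  have hcount : {x ∈ N | 𝓝[N ∩ Ioi x] x = ⊥}.Countable :=
    countable_setOfPred_isolated_right_within
  refine Set.Countable.mono (fun x hx => Set.mem_sep hx ?_) hcount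
  have h1 : ∀ᶠ z in 𝓝[N ∩ Ioi x] x, f z ≠ 0 :=
    ((hf x hx.1).eventually_ne hx.2.2).filter_mono
      (nhdsWithin_mono _ fun z hz => ne_of_gt hz.2)
  rw [← Filter.eventually_false_iff_eq_bot]
  filter_upwards [h1, self_mem_nhdsWithin] with z hz hzN
  exact hz hzN.1.2.1

lemma HasDerivAt.max_of_eq {f g : ℝ → ℝ} {c x : ℝ} (hf : HasDerivAt f c x)
    (hg : HasDerivAt g c x) (h : f x = g x) :
    HasDerivAt (fun y => max (f y) (g y)) c x := by
  rw [hasDerivAt_iff_isLittleO] at *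
  rw [Asymptotics.isLittleO_iff] at *
  intro ε hε
  filter_upwards [hf hε, hg hε] with y h1 h2
  rcases le_total (f y) (g y) with h3 | h3
  · simpa [max_eq_right h3, h] using h2
  · simpa [max_eq_left h3, h] using h1

lemma HasDerivAt.max_of_gt {f g : ℝ → ℝ} {c x : ℝ} (hf : HasDerivAt f c x)
    (hg : ContinuousAt g x) (h : g x < f x) :
    HasDerivAt (fun y => max (f y) (g y)) c x := by
  refine hf.congr_of_eventuallyEq ?_
  filter_upwards [hg.eventually_lt hf.continuousAt h] with y hy
  exact max_eq_left hy.le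

lemma deriv_smoothTransition_nonneg (x : ℝ) : 0 ≤ deriv Real.smoothTransition x :=
  Real.smoothTransition.monotone.deriv_nonneg

lemma deriv_smoothTransition_eq_zero_of_neg {x : ℝ} (hx : x < 0) :
    deriv Real.smoothTransition x = 0 := by
  rw [Filter.EventuallyEq.deriv_eq (f := fun _ => (0 : ℝ)), deriv_const]
  filter_upwards [eventually_lt_nhds hx] with y hy
  exact Real.smoothTransition.zero_of_nonpos hy.le

lemma deriv_smoothTransition_eq_zero_of_one_lt {x : ℝ} (hx : 1 < x) :
    deriv Real.smoothTransition x = 0 := by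
  rw [Filter.EventuallyEq.deriv_eq (f := fun _ => (1 : ℝ)), deriv_const]
  filter_upwards [eventually_gt_nhds hx] with y hy
  exact Real.smoothTransition.one_of_one_le hy.le

lemma exists_abs_mul_deriv_smoothTransition_le :
    ∃ K, ∀ x, |x| * deriv Real.smoothTransition x ≤ K := by
  have hc : Continuous (deriv Real.smoothTransition) :=
    (Real.smoothTransition.contDiff (n := 1)).continuous_deriv le_rfl
  obtain ⟨K, hK⟩ := (isCompact_Icc (a := (0 : ℝ)) (b := 1)).bddAbove_image
    (f := fun x => |x| * deriv Real.smoothTransition x) (by fun_prop)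
  refine ⟨max K 0, fun x => ?_⟩
  by_cases hx : x ∈ Icc (0 : ℝ) 1
  · exact (hK ⟨x, hx, rfl⟩).trans (le_max_left _ _)
  · refine le_trans (le_of_eq ?_) (le_max_right _ _)
    rw [mem_Icc, not_and_or, not_le, not_le] at hx
    rcases hx with hx | hx
    · rw [deriv_smoothTransition_eq_zero_of_neg hx, mul_zero]
    · rw [deriv_smoothTransition_eq_zero_of_one_lt hx, mul_zero]

/-- If `u` vanishes at the endpoints and `u * w'` is bounded below by a negative multiple of `|w|`
(so `u` has the sign of `w'` at the zeros of `w`), then the integral of `u'` over `{w > 0}` is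
nonpositive. -/
lemma integral_indicator_pos_nonpos {L C : ℝ} (hL : 0 ≤ L) {u w u' w' : ℝ → ℝ}
    (hu : ContinuousOn u (Icc 0 L)) (hw : ContinuousOn w (Icc 0 L))
    (hu' : ContinuousOn u' (Icc 0 L)) (hw' : ContinuousOn w' (Icc 0 L))
    (hdu : ∀ x ∈ Ioo 0 L, HasDerivAt u (u' x) x) (hdw : ∀ x ∈ Ioo 0 L, HasDerivAt w (w' x) x)
    (hu0 : u 0 = 0) (huL : u L = 0) (hC : 0 ≤ C)
    (huw : ∀ x ∈ Ioo 0 L, -(C * |w x|) ≤ u x * w' x) :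
    ∫ x in (0 : ℝ)..L, {x | 0 < w x}.indicator u' x ≤ 0 := by
  obtain ⟨K, hK⟩ := exists_abs_mul_deriv_smoothTransition_le
  have hTc : Continuous (deriv Real.smoothTransition) :=
    (Real.smoothTransition.contDiff (n := 1)).continuous_deriv le_rfl
  have hT : Continuous Real.smoothTransition := Real.smoothTransition.continuous
  set F : ℕ → ℝ → ℝ := fun n x => u' x * Real.smoothTransition (n * w x)
    - C * (|n * w x| * deriv Real.smoothTransition (n * w x)) with hF
  have hnw : ∀ n : ℕ, ContinuousOn (fun x => (n : ℝ) * w x) (Icc 0 L) :=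
    fun n => continuousOn_const.mul hw
  have hTn : ∀ n : ℕ, ContinuousOn (fun x => Real.smoothTransition (n * w x)) (Icc 0 L) :=
    fun n => hT.comp_continuousOn (hnw n)
  have hTcn : ∀ n : ℕ, ContinuousOn (fun x => deriv Real.smoothTransition (n * w x)) (Icc 0 L) :=
    fun n => hTc.comp_continuousOn (hnw n)
  have hFc : ∀ n, ContinuousOn (F n) (Icc 0 L) := fun n =>
    (hu'.mul (hTn n)).sub (continuousOn_const.mul ((hnw n).abs.mul (hTcn n)))
  have hFn : ∀ n, ∫ x in (0 : ℝ)..L, F n x ≤ 0 := by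
    intro n
    have hGc : ContinuousOn (fun x => u' x * Real.smoothTransition (n * w x)
        + u x * (deriv Real.smoothTransition (n * w x) * (n * w' x))) (Icc 0 L) :=
      (hu'.mul (hTn n)).add (hu.mul ((hTcn n).mul (continuousOn_const.mul hw')))
    have hGi := hGc.intervalIntegrable_of_Icc hL (μ := volume)
    have h0 := intervalIntegral.integral_eq_sub_of_hasDerivAt_of_le hL (hu.mul (hTn n))
      (fun x hx => (hdu x hx).mul
        (((Real.smoothTransition.contDiffAt (n := 1)).differentiableAt one_ne_zero
          |>.hasDerivAt).comp x ((hdw x hx).const_mul (n : ℝ)))) hGi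
    simp only [Pi.mul_apply, hu0, huL, zero_mul, sub_zero] at h0
    refine le_trans (intervalIntegral.integral_mono_on_of_le_Ioo hL
      ((hFc n).intervalIntegrable_of_Icc hL) hGi fun x hx => ?_) h0.le
    have h1 := mul_le_mul_of_nonneg_right (huw x hx)
      (mul_nonneg (Nat.cast_nonneg (α := ℝ) n) (deriv_smoothTransition_nonneg (n * w x)))
    simp only [hF, abs_mul, Nat.abs_cast]
    linarith
  obtain ⟨M, hM⟩ := isCompact_Icc.exists_bound_of_continuousOn hu'
  refine le_of_tendsto' (intervalIntegral.tendsto_integral_filter_of_dominated_convergence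
    (l := atTop) (F := F) (fun _ => M + C * K) ?_ ?_ ?_ ?_) hFn
  · refine Eventually.of_forall fun n => ?_
    rw [uIoc_of_le hL]
    exact ((hFc n).mono Ioc_subset_Icc_self).aestronglyMeasurable measurableSet_Ioc
  · refine Eventually.of_forall fun n => ae_of_all _ fun x hx => ?_
    rw [uIoc_of_le hL] at hx
    refine (norm_sub_le _ _).trans (add_le_add ?_ ?_)
    · rw [norm_mul]
      refine (mul_le_of_le_one_right (norm_nonneg _) ?_).trans (hM x (Ioc_subset_Icc_self hx))
      rw [Real.norm_of_nonneg (Real.smoothTransition.nonneg _)]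
      exact Real.smoothTransition.le_one _
    · rw [Real.norm_of_nonneg (mul_nonneg hC (mul_nonneg (abs_nonneg _)
        (deriv_smoothTransition_nonneg _)))]
      exact mul_le_mul_of_nonneg_left (hK _) hC
  · exact intervalIntegrable_const
  · refine ae_of_all _ fun x hx => ?_
    refine tendsto_const_nhds.congr' ?_
    rcases lt_trichotomy (w x) 0 with h | h | h
    · filter_upwards [eventually_gt_atTop 0] with n hn
      have : (n : ℝ) * w x < 0 := mul_neg_of_pos_of_neg (by exact_mod_cast hn) h
      simp [hF, indicator, h.not_gt, Real.smoothTransition.zero_of_nonpos this.le,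
        deriv_smoothTransition_eq_zero_of_neg this]
    · exact Eventually.of_forall fun n => by simp [hF, indicator, h]
    · filter_upwards [(tendsto_natCast_atTop_atTop.atTop_mul_const h).eventually_gt_atTop 1]
        with n hn
      simp [hF, indicator, h, Real.smoothTransition.one_of_one_le hn.le,
        deriv_smoothTransition_eq_zero_of_one_lt hn]

lemma hasDerivAt_sin_arctan (x : ℝ) :
    HasDerivAt (fun y => Real.sin (Real.arctan y)) (1 / (1 + x ^ 2) ^ ((3 : ℝ) / 2)) x := by
  refine (Real.hasDerivAt_arctan x).sin.congr_deriv ?_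
  have h : (0 : ℝ) < 1 + x ^ 2 := by positivity
  have h3 : (1 + x ^ 2 : ℝ) ^ ((3 : ℝ) / 2) = √(1 + x ^ 2) * (1 + x ^ 2) := by
    rw [show (3 : ℝ) / 2 = 1 / 2 + 1 by norm_num, Real.rpow_add_one h.ne', Real.sqrt_eq_rpow]
  rw [Real.cos_arctan, h3, div_mul_div_comm, one_mul]

/-- The right-hand side of the transformed flow equation, for a profile at a fixed time. -/
noncomputable def flowRhs (ψ a : ℝ → ℝ) (θ : ℝ) : ℝ :=
  (1 / ψ (a θ)) * (deriv (deriv a) θ / (1 + (deriv a θ) ^ 2) ^ ((3 : ℝ) / 2))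
    + (deriv ψ (a θ) / (ψ (a θ)) ^ 2) * ((deriv a θ) ^ 2 / √(1 + (deriv a θ) ^ 2))

/-- The integrand of the weak formulation at a fixed time, for the profile `m` with time
derivative `d` and the test function `e`. -/
noncomputable def weakIntegrand (ψ m e : ℝ → ℝ) (d θ : ℝ) : ℝ :=
  e θ * d + (1 / ψ (m θ)) * (deriv m θ * deriv e θ / √(1 + (deriv m θ) ^ 2))
    - 2 * (deriv ψ (m θ) / (ψ (m θ)) ^ 2) * ((deriv m θ) ^ 2 * e θ / √(1 + (deriv m θ) ^ 2))

/-- The flux `a' / (ψ(a) √(1 + a'²))` on `[0, L]`. -/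
noncomputable def flux (ψ a : ℝ → ℝ) (L θ : ℝ) : ℝ :=
  Real.sin (Real.arctan (derivWithin a (Icc 0 L) θ)) / ψ (a θ)

lemma contDiffOn_flux {ψ a : ℝ → ℝ} {L : ℝ} (hL : 0 < L) (hψ : ContDiff ℝ 1 ψ)
    (hψpos : ∀ s, 0 < ψ s) (ha : ContDiffOn ℝ 2 a (Icc 0 L)) :
    ContDiffOn ℝ 1 (flux ψ a L) (Icc 0 L) := by
  have h1 : ContDiffOn ℝ 1 (derivWithin a (Icc 0 L)) (Icc 0 L) :=
    ha.derivWithin (uniqueDiffOn_Icc hL) (by norm_num)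
  exact ((Real.contDiff_sin.comp Real.contDiff_arctan).comp_contDiffOn h1).div
    (hψ.comp_contDiffOn (ha.of_le (by norm_num))) fun x _ => (hψpos _).ne'

lemma hasDerivAt_derivWithin_of_mem_Ioo {f : ℝ → ℝ} {L x : ℝ}
    (hf : ContDiffOn ℝ 1 f (Icc 0 L)) (hx : x ∈ Ioo 0 L) :
    HasDerivAt f (derivWithin f (Icc 0 L) x) x :=
  ((hf.differentiableOn one_ne_zero x (Ioo_subset_Icc_self hx)).hasDerivWithinAt).hasDerivAt
    (Icc_mem_nhds hx.1 hx.2)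

lemma derivWithin_Icc_eq_deriv {f : ℝ → ℝ} {L x : ℝ} (hx : x ∈ Ioo 0 L) :
    derivWithin f (Icc 0 L) x = deriv f x :=
  derivWithin_of_mem_nhds (Icc_mem_nhds hx.1 hx.2)

/-- Divergence form of the right-hand side of the transformed flow equation. -/
lemma derivWithin_flux {ψ a : ℝ → ℝ} {L θ : ℝ} (hL : 0 < L) (hψ : ContDiff ℝ 1 ψ)
    (hψpos : ∀ s, 0 < ψ s) (ha : ContDiffOn ℝ 2 a (Icc 0 L)) (hθ : θ ∈ Ioo 0 L) :
    derivWithin (flux ψ a L) (Icc 0 L) θ = flowRhs ψ a θ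
      - 2 * (deriv ψ (a θ) / (ψ (a θ)) ^ 2) * ((deriv a θ) ^ 2 / √(1 + (deriv a θ) ^ 2)) := by
  have h1 : ContDiffOn ℝ 1 (derivWithin a (Icc 0 L)) (Icc 0 L) :=
    ha.derivWithin (uniqueDiffOn_Icc hL) (by norm_num)
  have hp := hasDerivAt_derivWithin_of_mem_Ioo h1 hθ
  have ha1 := hasDerivAt_derivWithin_of_mem_Ioo (ha.of_le (by norm_num)) hθ
  have hpp : derivWithin (derivWithin a (Icc 0 L)) (Icc 0 L) θ = deriv (deriv a) θ := by
    rw [derivWithin_Icc_eq_deriv hθ]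
    refine Filter.EventuallyEq.deriv_eq ?_
    filter_upwards [Ioo_mem_nhds hθ.1 hθ.2] with y hy using derivWithin_Icc_eq_deriv hy
  have hψd : HasDerivAt ψ (deriv ψ (a θ)) (a θ) :=
    (hψ.differentiable one_ne_zero _).hasDerivAt
  have h := ((hasDerivAt_sin_arctan _).comp θ hp).div (hψd.comp θ ha1) (hψpos _).ne'
  have h' : derivWithin (flux ψ a L) (Icc 0 L) θ = _ :=
    h.hasDerivWithinAt.derivWithin (uniqueDiffOn_Icc hL θ (Ioo_subset_Icc_self hθ))
  rw [h', hpp, derivWithin_Icc_eq_deriv hθ, flowRhs]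
  simp only [Function.comp_apply, Real.sin_arctan, derivWithin_Icc_eq_deriv hθ]
  have h2 := (hψpos (a θ)).ne'
  have h3 : √(1 + (deriv a θ) ^ 2) ≠ 0 := by positivity
  have h4 : (1 + (deriv a θ) ^ 2) ^ ((3 : ℝ) / 2) ≠ 0 := by positivity
  field_simp
  ring

lemma weakIntegrand_le {ψ a m e : ℝ → ℝ} {L d θ : ℝ} (hL : 0 < L) (hψ : ContDiff ℝ 1 ψ)
    (hψpos : ∀ s, 0 < ψ s) (ha : ContDiffOn ℝ 2 a (Icc 0 L)) (he0 : 0 ≤ e θ)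
    (hθ : θ ∈ Ioo 0 L) (hm : m θ = a θ) (hm' : deriv m θ = deriv a θ)
    (hd : d ≤ flowRhs ψ a θ) :
    weakIntegrand ψ m e d θ ≤ derivWithin e (Icc 0 L) θ * flux ψ a L θ
      + e θ * derivWithin (flux ψ a L) (Icc 0 L) θ := by
  rw [derivWithin_flux hL hψ hψpos ha hθ, weakIntegrand, hm, hm', flux, Real.sin_arctan,
    derivWithin_Icc_eq_deriv hθ, derivWithin_Icc_eq_deriv hθ]
  have h := mul_le_mul_of_nonneg_left hd he0
  have h2 : (1 / ψ (a θ)) * (deriv a θ * deriv e θ / √(1 + (deriv a θ) ^ 2))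
      = deriv e θ * (deriv a θ / √(1 + (deriv a θ) ^ 2) / ψ (a θ)) := by ring
  rw [h2, mul_sub]
  linear_combination h

/-- At points where two profiles are close, the difference of their fluxes has almost the sign of
the difference of their slopes. -/
lemma exists_flux_sub_mul_ge {ψ a b e : ℝ → ℝ} {L : ℝ} (hL : 0 < L) (hψ : ContDiff ℝ 1 ψ)
    (hψpos : ∀ s, 0 < ψ s) (ha : ContDiffOn ℝ 2 a (Icc 0 L)) (hb : ContDiffOn ℝ 2 b (Icc 0 L))
    (he : ContinuousOn e (Icc 0 L)) (he0 : ∀ θ ∈ Icc 0 L, 0 ≤ e θ) :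
    ∃ C, 0 ≤ C ∧ ∀ θ ∈ Icc 0 L, -(C * |a θ - b θ|) ≤ e θ * (flux ψ a L θ - flux ψ b L θ)
      * (derivWithin a (Icc 0 L) θ - derivWithin b (Icc 0 L) θ) := by
  have hU := uniqueDiffOn_Icc hL
  obtain ⟨A, hA⟩ := isCompact_Icc.exists_bound_of_continuousOn ha.continuousOn
  obtain ⟨B, hB⟩ := isCompact_Icc.exists_bound_of_continuousOn hb.continuousOn
  obtain ⟨E, hE⟩ := isCompact_Icc.exists_bound_of_continuousOn (he.mul
    ((ha.continuousOn_derivWithin hU (by norm_num)).sub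
      (hb.continuousOn_derivWithin hU (by norm_num))))
  obtain ⟨K, hK⟩ := (hψ.inv fun s => (hψpos s).ne').contDiffOn.exists_lipschitzOnWith
    (s := Icc (-(max A B)) (max A B)) one_ne_zero (convex_Icc _ _) isCompact_Icc
  have hE0 : 0 ≤ E := (norm_nonneg _).trans (hE 0 (left_mem_Icc.2 hL.le))
  refine ⟨E * K, by positivity, fun θ hθ => ?_⟩
  have hKab : |(ψ (a θ))⁻¹ - (ψ (b θ))⁻¹| ≤ K * |a θ - b θ| := by
    have := hK.norm_sub_le (x := a θ) (y := b θ)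
      (abs_le.1 ((hA θ hθ).trans (le_max_left _ _))) (abs_le.1 ((hB θ hθ).trans (le_max_right _ _)))
    simpa using this
  set p := derivWithin a (Icc 0 L) θ
  set q := derivWithin b (Icc 0 L) θ
  have hEθ : |e θ * (p - q)| ≤ E := hE θ hθ
  have hmono : 0 ≤ (Real.sin (Real.arctan p) - Real.sin (Real.arctan q)) * (p - q) := by
    rcases le_total p q with h | h
    · exact mul_nonneg_of_nonpos_of_nonpos
        (sub_nonpos.2 (Real.sin_arctan_strictMono.monotone h)) (sub_nonpos.2 h)
    · exact mul_nonneg (sub_nonneg.2 (Real.sin_arctan_strictMono.monotone h)) (sub_nonneg.2 h)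
  have hmain : 0 ≤ e θ * (ψ (a θ))⁻¹ *
      ((Real.sin (Real.arctan p) - Real.sin (Real.arctan q)) * (p - q)) :=
    mul_nonneg (mul_nonneg (he0 θ hθ) (inv_nonneg.2 (hψpos _).le)) hmono
  have herr : |e θ * (p - q) * (Real.sin (Real.arctan q) * ((ψ (a θ))⁻¹ - (ψ (b θ))⁻¹))|
      ≤ E * (1 * (K * |a θ - b θ|)) := by
    rw [abs_mul, abs_mul (Real.sin _)]
    gcongr
    exact Real.abs_sin_le_one _
  have h3 := (abs_le.1 herr).1
  simp only [flux, div_eq_mul_inv]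
  linear_combination h3 + hmain

/-- The fixed-time inequality behind the weak subsolution property of a maximum. -/
lemma integral_weakIntegrand_max_nonpos {ψ a b m e D : ℝ → ℝ} {L : ℝ} (hL : 0 < L)
    (hψ : ContDiff ℝ 1 ψ) (hψpos : ∀ s, 0 < ψ s) (ha : ContDiffOn ℝ 2 a (Icc 0 L))
    (hb : ContDiffOn ℝ 2 b (Icc 0 L)) (hm : ∀ θ, m θ = max (a θ) (b θ))
    (he : ContDiffOn ℝ 1 e (Icc 0 L)) (he0 : ∀ θ ∈ Icc 0 L, 0 ≤ e θ) (hel : e 0 = 0)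
    (her : e L = 0)
    (hDa : ∀ᵐ θ, θ ∈ Ioo 0 L → b θ < a θ → D θ ≤ flowRhs ψ a θ)
    (hDb : ∀ᵐ θ, θ ∈ Ioo 0 L → a θ ≤ b θ → D θ ≤ flowRhs ψ b θ) :
    ∫ θ in (0 : ℝ)..L, weakIntegrand ψ m e (D θ) θ ≤ 0 := by
  by_cases hint : IntervalIntegrable (fun θ => weakIntegrand ψ m e (D θ) θ) volume 0 L
  swap
  · exact (intervalIntegral.integral_undef hint).le
  have hU := uniqueDiffOn_Icc hL
  have ha1 : ContDiffOn ℝ 1 a (Icc 0 L) := ha.of_le (by norm_num)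
  have hb1 : ContDiffOn ℝ 1 b (Icc 0 L) := hb.of_le (by norm_num)
  have hFa := contDiffOn_flux hL hψ hψpos ha
  have hFb := contDiffOn_flux hL hψ hψpos hb
  set Ga : ℝ → ℝ := fun θ => derivWithin e (Icc 0 L) θ * flux ψ a L θ
      + e θ * derivWithin (flux ψ a L) (Icc 0 L) θ
  set Gb : ℝ → ℝ := fun θ => derivWithin e (Icc 0 L) θ * flux ψ b L θ
      + e θ * derivWithin (flux ψ b L) (Icc 0 L) θ
  have he'c := he.continuousOn_derivWithin hU le_rfl
  have hGac : ContinuousOn Ga (Icc 0 L) := (he'c.mul hFa.continuousOn).add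
    (he.continuousOn.mul (hFa.continuousOn_derivWithin hU le_rfl))
  have hGbc : ContinuousOn Gb (Icc 0 L) := (he'c.mul hFb.continuousOn).add
    (he.continuousOn.mul (hFb.continuousOn_derivWithin hU le_rfl))
  have hGad : ∀ x ∈ Ioo 0 L, HasDerivAt (fun θ => e θ * flux ψ a L θ) (Ga x) x := fun x hx =>
    (hasDerivAt_derivWithin_of_mem_Ioo he hx).mul (hasDerivAt_derivWithin_of_mem_Ioo hFa hx)
  have hGbd : ∀ x ∈ Ioo 0 L, HasDerivAt (fun θ => e θ * flux ψ b L θ) (Gb x) x := fun x hx =>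
    (hasDerivAt_derivWithin_of_mem_Ioo he hx).mul (hasDerivAt_derivWithin_of_mem_Ioo hFb hx)
  have hGb0 : ∫ θ in (0 : ℝ)..L, Gb θ = 0 := by
    rw [intervalIntegral.integral_eq_sub_of_hasDerivAt_of_le hL.le
      (he.continuousOn.mul hFb.continuousOn) hGbd (hGbc.intervalIntegrable_of_Icc hL.le)]
    simp [hel, her]
  obtain ⟨C, hC, hCle⟩ := exists_flux_sub_mul_ge hL hψ hψpos ha hb he.continuousOn he0
  have hwc : ContinuousOn (fun θ => a θ - b θ) (Icc 0 L) :=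
    ha.continuousOn.sub hb.continuousOn
  have hwd : ∀ x ∈ Ioo 0 L, HasDerivAt (fun θ => a θ - b θ)
      (derivWithin a (Icc 0 L) x - derivWithin b (Icc 0 L) x) x := fun x hx =>
    (hasDerivAt_derivWithin_of_mem_Ioo ha1 hx).sub (hasDerivAt_derivWithin_of_mem_Ioo hb1 hx)
  have hind := integral_indicator_pos_nonpos (C := C) hL.le
    (u := fun θ => e θ * flux ψ a L θ - e θ * flux ψ b L θ) (w := fun θ => a θ - b θ)
    (u' := fun θ => Ga θ - Gb θ)
    ((he.continuousOn.mul hFa.continuousOn).sub (he.continuousOn.mul hFb.continuousOn)) hwc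
    (hGac.sub hGbc) ((ha1.continuousOn_derivWithin hU le_rfl).sub
      (hb1.continuousOn_derivWithin hU le_rfl))
    (fun x hx => (hGad x hx).sub (hGbd x hx)) hwd (by simp [hel]) (by simp [her]) hC
    (fun x hx => by
      have := hCle x (Ioo_subset_Icc_self hx)
      rwa [mul_sub (e x)] at this)
  have hindi : IntervalIntegrable ({x | 0 < a x - b x}.indicator fun θ => Ga θ - Gb θ)
      volume 0 L := by
    have hmeas : MeasurableSet (Ioo 0 L ∩ {x | 0 < a x - b x}) :=
      ((hwc.mono Ioo_subset_Icc_self).isOpen_inter_preimage isOpen_Ioo isOpen_Ioi).measurableSet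
    have h1 := ((hGac.sub hGbc).integrableOn_Icc (μ := volume)).mono_set Ioo_subset_Icc_self
    rw [intervalIntegrable_iff_integrableOn_Ioo_of_le hL.le]
    refine (h1.indicator hmeas).congr_fun_ae ?_
    filter_upwards [ae_restrict_mem measurableSet_Ioo] with x hx
    simp [indicator, hx.1, hx.2]
  have hcross : ∀ᵐ x : ℝ, x ∉ {x ∈ Ioo 0 L | a x - b x = 0 ∧
      derivWithin a (Icc 0 L) x - derivWithin b (Icc 0 L) x ≠ 0} :=
    (countable_zeros_of_hasDerivAt_ne_zero hwd).ae_notMem _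
  calc ∫ θ in (0 : ℝ)..L, weakIntegrand ψ m e (D θ) θ
      ≤ ∫ θ in (0 : ℝ)..L,
          (({x | 0 < a x - b x}.indicator (fun θ => Ga θ - Gb θ)) θ + Gb θ) := by
        have hGbi := hGbc.intervalIntegrable_of_Icc hL.le (μ := volume)
        simp only [intervalIntegral.integral_of_le hL.le, integral_Ioc_eq_integral_Ioo]
        refine setIntegral_mono_on_ae (hint.1.mono_set Ioo_subset_Ioc_self)
          ((hindi.add hGbi).1.mono_set Ioo_subset_Ioc_self) measurableSet_Ioo ?_
        filter_upwards [hDa, hDb, hcross] with x hxa hxb hxc hx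
        have hax := hasDerivAt_derivWithin_of_mem_Ioo ha1 hx
        have hbx := hasDerivAt_derivWithin_of_mem_Ioo hb1 hx
        have hmeq : m = fun y => max (a y) (b y) := funext hm
        have hmeq' : m = fun y => max (b y) (a y) := funext fun y => (hm y).trans (max_comm _ _)
        have he0x := he0 x (Ioo_subset_Icc_self hx)
        rcases lt_trichotomy (b x) (a x) with h | h | h
        · have := weakIntegrand_le hL hψ hψpos ha he0x hx (m := m) (d := D x)
            ((hm x).trans (max_eq_left h.le))
            (by rw [hmeq, (hax.max_of_gt hbx.continuousAt h).deriv, hax.deriv]) (hxa hx h)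
          simpa [indicator, h] using this
        · have hab' : derivWithin a (Icc 0 L) x = derivWithin b (Icc 0 L) x := by
            by_contra hne
            exact hxc ⟨hx, sub_eq_zero.2 h.symm, sub_ne_zero.2 hne⟩
          have hax' : HasDerivAt a (derivWithin b (Icc 0 L) x) x := hab' ▸ hax
          have := weakIntegrand_le hL hψ hψpos hb he0x hx (m := m) (d := D x)
            ((hm x).trans (max_eq_right h.ge))
            (by rw [hmeq, (hax'.max_of_eq hbx h.symm).deriv, hbx.deriv]) (hxb hx h.ge)
          simpa [indicator, h] using this
        · have := weakIntegrand_le hL hψ hψpos hb he0x hx (m := m) (d := D x)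
            ((hm x).trans (max_eq_right h.le))
            (by rw [hmeq', (hbx.max_of_gt hax.continuousAt h).deriv, hbx.deriv]) (hxb hx h.le)
          simpa [indicator, h.not_gt] using this
    _ ≤ 0 := by
        rw [intervalIntegral.integral_add hindi (hGbc.intervalIntegrable_of_Icc hL.le), hGb0,
          add_zero]
        exact hind

lemma hasDerivAt_fderiv_snd {W : ℝ × ℝ → ℝ} {x t : ℝ} (hW : DifferentiableAt ℝ W (x, t)) :
    HasDerivAt (fun s => W (x, s)) (fderiv ℝ W (x, t) (0, 1)) t :=
  hW.hasFDerivAt.comp_hasDerivAt t ((hasDerivAt_const t x).prodMk (hasDerivAt_id t))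

/-- The part of the zero set of a `C¹` function where its second partial derivative does not
vanish is null on almost every slice with fixed second coordinate. -/
lemma ae_ae_fderiv_snd_eq_zero {W : ℝ × ℝ → ℝ} {Ω : Set (ℝ × ℝ)} (hΩ : IsOpen Ω)
    (hW : ContDiffOn ℝ 1 W Ω) :
    ∀ᵐ t : ℝ, ∀ᵐ x : ℝ, (x, t) ∈ Ω → W (x, t) = 0 → fderiv ℝ W (x, t) (0, 1) = 0 := by
  have hW' : ContinuousOn (fun z => fderiv ℝ W z (0, 1)) Ω :=
    (hW.continuousOn_fderiv_of_isOpen hΩ le_rfl).clm_apply continuousOn_const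
  have hmeas : MeasurableSet
      {z : ℝ × ℝ | z ∈ Ω → W z = 0 → fderiv ℝ W z (0, 1) = 0} := by
    have h1 := (hW'.isOpen_inter_preimage hΩ isOpen_compl_singleton (t := {0}ᶜ)).measurableSet
    have h2 := (hW.continuousOn.isOpen_inter_preimage hΩ
      isOpen_compl_singleton (t := {0}ᶜ)).measurableSet
    convert (h1.diff h2).compl using 1
    ext z
    simp only [mem_ofPred_eq, mem_compl_iff, Set.mem_sdiff, mem_inter_iff, mem_preimage,
      mem_singleton_iff]
    tauto
  refine (Measure.ae_ae_comm (p := fun x t =>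
    (x, t) ∈ Ω → W (x, t) = 0 → fderiv ℝ W (x, t) (0, 1) = 0) hmeas).1 (ae_of_all _ fun x => ?_)
  have hcount := countable_zeros_of_hasDerivAt_ne_zero (s := {t | (x, t) ∈ Ω})
    (f := fun t => W (x, t)) (f' := fun t => fderiv ℝ W (x, t) (0, 1)) fun t ht =>
      hasDerivAt_fderiv_snd
        ((hW.contDiffAt (hΩ.mem_nhds ht)).differentiableAt one_ne_zero)
  filter_upwards [hcount.ae_notMem volume] with t ht h1 h2
  by_contra h3
  exact ht ⟨h1, h2, h3⟩

/-- **The maximum of two pointwise subsolutions is a weak subsolution** (the claim in the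
proof of Theorem 2 that `ζ = max(ζ₁, ζ₂)` is a weak subsolution of the equation in
(Th2Eq3)), in the divergence-form (integrated-by-parts) formulation. -/
theorem max_of_subsolutions_is_weak_subsolution
    (ψ : ℝ → ℝ) (hψ : ContDiff ℝ 1 ψ) (hψpos : ∀ s, 0 < ψ s)
    (L τ : ℝ) (hL : 0 < L) (hτ : 0 < τ)
    (ζ₁ ζ₂ : ℝ → ℝ → ℝ)
    (hζ₁ : ContDiffOn ℝ 2 (Function.uncurry ζ₁) (Icc 0 L ×ˢ Ico 0 τ))
    (hζ₂ : ContDiffOn ℝ 2 (Function.uncurry ζ₂) (Icc 0 L ×ˢ Ico 0 τ))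
    (hsub₁ : ∀ θ ∈ Icc 0 L, ∀ t ∈ Ico 0 τ, SubSolTrans ψ ζ₁ θ t)
    (hsub₂ : ∀ θ ∈ Icc 0 L, ∀ t ∈ Ico 0 τ, SubSolTrans ψ ζ₂ θ t)
    (ζ : ℝ → ℝ → ℝ) (hζ : ∀ θ t, ζ θ t = max (ζ₁ θ t) (ζ₂ θ t)) :
    ∀ τ' ∈ Ioo 0 τ, ∀ η : ℝ → ℝ → ℝ,
      ContDiffOn ℝ 1 (Function.uncurry η) (Icc 0 L ×ˢ Icc 0 τ') →
      (∀ θ ∈ Icc 0 L, ∀ t ∈ Icc 0 τ', 0 ≤ η θ t) →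
      (∀ t ∈ Icc 0 τ', η 0 t = 0 ∧ η L t = 0) →
      (∫ t in (0:ℝ)..τ', ∫ θ in (0:ℝ)..L,
          (η θ t * deriv (fun s => ζ θ s) t
            + (1 / ψ (ζ θ t)) *
                (deriv (fun z => ζ z t) θ * deriv (fun z => η z t) θ /
                  Real.sqrt (1 + (deriv (fun z => ζ z t) θ) ^ 2))
            - 2 * (deriv ψ (ζ θ t) / (ψ (ζ θ t)) ^ 2) *
                ((deriv (fun z => ζ z t) θ) ^ 2 * η θ t /
                  Real.sqrt (1 + (deriv (fun z => ζ z t) θ) ^ 2)))) ≤ 0 := by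
  intro τ' hτ' η hη hη0 hηb
  have hΩ : IsOpen (Ioo 0 L ×ˢ Ioo 0 τ) := isOpen_Ioo.prod isOpen_Ioo
  have hsub : Ioo 0 L ×ˢ Ioo 0 τ ⊆ Icc 0 L ×ˢ Ico 0 τ :=
    prod_mono Ioo_subset_Icc_self Ioo_subset_Ico_self
  have h1 : ContDiffOn ℝ 1 (Function.uncurry ζ₁) (Ioo 0 L ×ˢ Ioo 0 τ) :=
    (hζ₁.mono hsub).of_le (by norm_num)
  have h2 : ContDiffOn ℝ 1 (Function.uncurry ζ₂) (Ioo 0 L ×ˢ Ioo 0 τ) :=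
    (hζ₂.mono hsub).of_le (by norm_num)
  rw [intervalIntegral.integral_of_le hτ'.1.le]
  refine integral_nonpos_of_ae ?_
  rw [Filter.EventuallyLE, ae_restrict_iff' measurableSet_Ioc]
  filter_upwards [ae_ae_fderiv_snd_eq_zero
    (W := Function.uncurry ζ₁ - Function.uncurry ζ₂) hΩ (h1.sub h2)] with t htae ht
  have htτ : t ∈ Ioo 0 τ := ⟨ht.1, ht.2.trans_lt hτ'.2⟩
  have ht' : t ∈ Icc 0 τ' := Ioc_subset_Icc_self ht
  have hslice : ContDiff ℝ 2 fun z : ℝ => (z, t) := contDiff_id.prodMk contDiff_const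
  have hd1 : ∀ x ∈ Ioo 0 L, DifferentiableAt ℝ (Function.uncurry ζ₁) (x, t) := fun x hx =>
    (h1.contDiffAt (hΩ.mem_nhds ⟨hx, htτ⟩)).differentiableAt one_ne_zero
  have hd2 : ∀ x ∈ Ioo 0 L, DifferentiableAt ℝ (Function.uncurry ζ₂) (x, t) := fun x hx =>
    (h2.contDiffAt (hΩ.mem_nhds ⟨hx, htτ⟩)).differentiableAt one_ne_zero
  have ht1 : ∀ x ∈ Ioo 0 L, HasDerivAt (fun s => ζ₁ x s) (deriv (fun s => ζ₁ x s) t) t :=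
    fun x hx => (hasDerivAt_fderiv_snd (hd1 x hx)).differentiableAt.hasDerivAt
  have ht2 : ∀ x ∈ Ioo 0 L, HasDerivAt (fun s => ζ₂ x s) (deriv (fun s => ζ₂ x s) t) t :=
    fun x hx => (hasDerivAt_fderiv_snd (hd2 x hx)).differentiableAt.hasDerivAt
  have hζx : ∀ x, (fun s => ζ x s) = fun s => max (ζ₁ x s) (ζ₂ x s) := fun x => funext (hζ x)
  have hζx' : ∀ x, (fun s => ζ x s) = fun s => max (ζ₂ x s) (ζ₁ x s) := fun x =>
    funext fun s => (hζ x s).trans (max_comm _ _)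
  refine integral_weakIntegrand_max_nonpos (a := fun z => ζ₁ z t) (b := fun z => ζ₂ z t)
    (m := fun z => ζ z t) (e := fun z => η z t) (D := fun θ => deriv (fun s => ζ θ s) t)
    hL hψ hψpos
    (hζ₁.comp hslice.contDiffOn fun z hz => ⟨hz, Ioo_subset_Ico_self htτ⟩)
    (hζ₂.comp hslice.contDiffOn fun z hz => ⟨hz, Ioo_subset_Ico_self htτ⟩)
    (fun θ => hζ θ t)
    (hη.comp (hslice.of_le (by norm_num)).contDiffOn fun z hz => ⟨hz, ht'⟩)
    (fun θ hθ => hη0 θ hθ t ht') (hηb t ht').1 (hηb t ht').2 ?_ ?_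
  · refine ae_of_all _ fun x hx hlt => ?_
    rw [hζx, ((ht1 x hx).max_of_gt (ht2 x hx).continuousAt hlt).deriv]
    exact hsub₁ x (Ioo_subset_Icc_self hx) t (Ioo_subset_Ico_self htτ)
  · filter_upwards [htae] with x hxae hx hle
    refine le_trans (le_of_eq ?_)
      (hsub₂ x (Ioo_subset_Icc_self hx) t (Ioo_subset_Ico_self htτ))
    rcases hle.lt_or_eq with hlt | heq
    · rw [hζx', ((ht2 x hx).max_of_gt (ht1 x hx).continuousAt hlt).deriv]
    · have hw := hasDerivAt_fderiv_snd ((hd1 x hx).sub (hd2 x hx))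
      rw [hxae ⟨hx, htτ⟩ (sub_eq_zero.2 heq)] at hw
      have hdt : deriv (fun s => ζ₁ x s) t = deriv (fun s => ζ₂ x s) t :=
        sub_eq_zero.1 (((ht1 x hx).sub (ht2 x hx)).unique hw)
      have ht1' : HasDerivAt (fun s => ζ₁ x s) (deriv (fun s => ζ₂ x s) t) t := hdt ▸ ht1 x hx
      rw [hζx, (ht1'.max_of_eq (ht2 x hx) heq).deriv]
end
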